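/- For a semigroup X the following conditions are equivalent: (1) λ(X) is a commutative Clifford semigroup; (2) λ(X) is an inverse semigroup; (3) the idempotents of the semigroup λ(X) commute and λ(X) is sub-Clifford or regular in N₂(X); (4) X is a finite commutative Clifford semigroup isomorphic to one of the following semigroups: C₂, C₃, C₄, C₂×C₂, L₂×C₂, L₁⊔C₂, Lₙ, or C₂⊔Lₙ for some integer n ≥ 0. -/

import Mathlib

open Set

/-- An *upfamily* on `X`: a nonempty family of nonempty subsets of `X`
that is closed under taking supersets. -/
def IsUpfamily {X : Type*} (F : Set (Set X)) : Prop :=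
  F.Nonempty ∧ (∀ A ∈ F, A.Nonempty) ∧ ∀ A ∈ F, ∀ B : Set X, A ⊆ B → B ∈ F

/-- The space `υ(X)` of upfamilies on `X`. -/
def Upfamily (X : Type*) : Type _ := {F : Set (Set X) // IsUpfamily F}

/-- The extension of the binary operation of `X` to families of subsets of `X`:
`𝓐*𝓑 = ⟨⋃_{a ∈ A} a*B_a : A ∈ 𝓐, {B_a}_{a∈A} ⊆ 𝓑⟩`. -/
def upMul {X : Type*} [Mul X] (F G : Set (Set X)) : Set (Set X) :=
  {C | ∃ A ∈ F, ∃ B : X → Set X, (∀ a ∈ A, B a ∈ G) ∧ (⋃ a ∈ A, (fun y => a * y) '' B a) ⊆ C}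

theorem IsUpfamily.upMul {X : Type*} [Mul X] {F G : Set (Set X)}
    (hF : IsUpfamily F) (hG : IsUpfamily G) : IsUpfamily (upMul F G) := by
  obtain ⟨⟨A0, hA0⟩, hFne, hFup⟩ := hF
  obtain ⟨⟨B0, hB0⟩, hGne, hGup⟩ := hG
  refine ⟨⟨univ, A0, hA0, fun _ => B0, fun a _ => hB0, subset_univ _⟩, ?_, ?_⟩
  · rintro C ⟨A, hA, B, hB, hsub⟩
    obtain ⟨a, ha⟩ := hFne A hA
    obtain ⟨b, hb⟩ := hGne (B a) (hB a ha)
    exact ⟨a * b, hsub (mem_biUnion ha ⟨b, hb, rfl⟩)⟩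
  · rintro C ⟨A, hA, B, hB, hsub⟩ D hCD
    exact ⟨A, hA, B, hB, hsub.trans hCD⟩

/-- `υ(X)` is a semigroup under the extended operation. -/
instance {X : Type*} [Mul X] : Mul (Upfamily X) :=
  ⟨fun F G => ⟨upMul F.1 G.1, F.2.upMul G.2⟩⟩

/-- The embedding `X → υ(X)`, `x ↦ ⟨x⟩ = {A ⊆ X : x ∈ A}`. -/
def Upfamily.principal {X : Type*} (x : X) : Upfamily X :=
  ⟨{A | x ∈ A}, ⟨univ, mem_univ x⟩, fun A hA => ⟨x, hA⟩, fun _ hA _ hAB => hAB hA⟩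

/-- An upfamily is linked if any two of its members intersect. -/
def Upfamily.Linked {X : Type*} (F : Upfamily X) : Prop :=
  ∀ A ∈ F.1, ∀ B ∈ F.1, (A ∩ B).Nonempty

/-- Maximal linked upfamilies. -/
def Upfamily.IsMaxLinked {X : Type*} (F : Upfamily X) : Prop :=
  F.Linked ∧ ∀ G : Upfamily X, G.Linked → F.1 ⊆ G.1 → F = G

/-- Filters: upfamilies closed under binary intersections. -/
def Upfamily.IsFilter {X : Type*} (F : Upfamily X) : Prop :=
  ∀ A ∈ F.1, ∀ B ∈ F.1, A ∩ B ∈ F.1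

/-- Ultrafilters: maximal filters. -/
def Upfamily.IsUltrafilter {X : Type*} (F : Upfamily X) : Prop :=
  F.IsFilter ∧ ∀ G : Upfamily X, G.IsFilter → F.1 ⊆ G.1 → F = G

/-- The superextension `λ(X)` of maximal linked upfamilies. -/
def lambdaS (X : Type*) : Set (Upfamily X) := {F | F.IsMaxLinked}

/-- The semigroup `N₂(X)` of linked upfamilies. -/
def N2S (X : Type*) : Set (Upfamily X) := {F | F.Linked}

/-- The semigroup `φ(X)` of filters. -/
def phiS (X : Type*) : Set (Upfamily X) := {F | F.IsFilter}

/-- The Stone-Čech extension `β(X)` of ultrafilters. -/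
def betaS (X : Type*) : Set (Upfamily X) := {F | F.IsUltrafilter}

section SemigroupProps

variable {M : Type*} [Mul M]

/-- A subset closed under multiplication (i.e. a subsemigroup). -/
def mulClosed (S : Set M) : Prop := ∀ a ∈ S, ∀ b ∈ S, a * b ∈ S

/-- The operation is commutative on `S`. -/
def commOn (S : Set M) : Prop := ∀ a ∈ S, ∀ b ∈ S, a * b = b * a

/-- The idempotents of `S` commute. -/
def idemCommOn (S : Set M) : Prop :=
  ∀ a ∈ S, ∀ b ∈ S, a * a = a → b * b = b → a * b = b * a

/-- `S` is an inverse semigroup: every element has a unique inverse in `S`. -/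
def inverseOn (S : Set M) : Prop :=
  ∀ a ∈ S, ∃! b, b ∈ S ∧ a * b * a = a ∧ b * a * b = b

/-- `H` is a subgroup of the ambient multiplicative structure:
it is closed under multiplication and carries a group structure. -/
def IsSubgroupIn (H : Set M) : Prop :=
  (∀ a ∈ H, ∀ b ∈ H, a * b ∈ H) ∧
    ∃ e ∈ H, (∀ a ∈ H, e * a = a ∧ a * e = a) ∧ ∀ a ∈ H, ∃ b ∈ H, a * b = e ∧ b * a = e

/-- `S` is a Clifford semigroup: a union of groups. -/
def cliffordOn (S : Set M) : Prop := ∀ a ∈ S, ∃ H ⊆ S, IsSubgroupIn H ∧ a ∈ H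

/-- `S` is regular in `T`: every `a ∈ S` satisfies `a ∈ a T a`. -/
def regularIn (S T : Set M) : Prop := ∀ a ∈ S, ∃ b ∈ T, a * b * a = a

/-- `ppow a n = a^(n+1)`: positive powers in a semigroup. -/
def ppow (a : M) : ℕ → M
  | 0 => a
  | n + 1 => ppow a n * a

/-- `S` is sub-Clifford: `x^{n+1} = x^{m+1}` implies `x^n = x^m` for positive `n < m`. -/
def subCliffordOn (S : Set M) : Prop :=
  ∀ a ∈ S, ∀ n m : ℕ, n < m → ppow a (n + 1) = ppow a (m + 1) → ppow a n = ppow a m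

end SemigroupProps

/-- The cyclic group `Cₙ` of order `n`. -/
abbrev Cgrp (n : ℕ) : Type := Multiplicative (ZMod n)

/-- The linear semilattice `Lₙ = {0,…,n-1}` with the operation of minimum. -/
def L (n : ℕ) : Type := Fin n

instance {n : ℕ} : Mul (L n) :=
  ⟨fun a b => show Fin n from min (show Fin n from a) (show Fin n from b)⟩

/-- The disjoint ordered union `X ⊔ Y` of two semigroups, in which
`x * y = y * x = x` for `x ∈ X` and `y ∈ Y`. -/
abbrev OSum (A B : Type*) : Type _ := A ⊕ B

instance {A B : Type*} [Mul A] [Mul B] : Mul (OSum A B) :=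
  ⟨fun x y =>
    match x, y with
    | Sum.inl a, Sum.inl a' => Sum.inl (a * a')
    | Sum.inl a, Sum.inr _ => Sum.inl a
    | Sum.inr _, Sum.inl a => Sum.inl a
    | Sum.inr b, Sum.inr b' => Sum.inr (b * b')⟩

/-- `M` is isomorphic to the sub-semigroup `S` of `N`: there is an injective
operation-preserving map of `M` onto `S`. -/
def MulIsoOnto (M : Type*) [Mul M] {N : Type*} [Mul N] (S : Set N) : Prop :=
  ∃ f : M → N, Function.Injective f ∧ Set.range f = S ∧ ∀ x y : M, f (x * y) = f x * f y

namespace Upfamily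

variable {X Y : Type*}

theorem ext {F G : Upfamily X} (h : ∀ A, A ∈ F.1 ↔ A ∈ G.1) : F = G :=
  Subtype.ext (Set.ext h)

theorem mono (F : Upfamily X) {A B : Set X} (hA : A ∈ F.1) (h : A ⊆ B) : B ∈ F.1 :=
  F.2.2.2 A hA B h

theorem nonempty_of_mem (F : Upfamily X) {A : Set X} (hA : A ∈ F.1) : A.Nonempty :=
  F.2.2.1 A hA

theorem univ_mem (F : Upfamily X) : univ ∈ F.1 :=
  let ⟨_, hA⟩ := F.2.1
  F.mono hA (subset_univ _)

theorem empty_notMem (F : Upfamily X) : ∅ ∉ F.1 := fun h =>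
  not_nonempty_empty (F.nonempty_of_mem h)

theorem mem_mul [Mul X] (F G : Upfamily X) (C : Set X) :
    C ∈ (F * G).1 ↔ {x | {y | x * y ∈ C} ∈ G.1} ∈ F.1 := by
  constructor
  · rintro ⟨A, hA, B, hB, hC⟩
    refine F.mono hA fun a ha => G.mono (hB a ha) fun b hb => hC ?_
    exact mem_biUnion ha ⟨b, hb, rfl⟩
  · intro h
    refine ⟨_, h, fun x => {y | x * y ∈ C}, fun a ha => ha, ?_⟩
    rintro _ ⟨_, ⟨a, rfl⟩, _, ⟨ha, rfl⟩, b, hb, rfl⟩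
    exact hb

instance [Semigroup X] : Semigroup (Upfamily X) where
  mul_assoc F G H := ext fun C => by simp only [mem_mul, mem_ofPred_eq, mul_assoc]

theorem mem_lambdaS {F : Upfamily X} : F ∈ lambdaS X ↔ ∀ A, Aᶜ ∈ F.1 ↔ A ∉ F.1 := by
  constructor
  · rintro ⟨hl, hm⟩ A
    refine ⟨fun h h' => ?_, fun h => ?_⟩
    · simpa using hl A h' _ h
    · by_contra hc
      have key : ∀ B ∈ F.1, (B ∩ A).Nonempty := fun B hB => by
        by_contra hBA
        refine hc (F.mono hB fun x hx hxA => hBA ⟨x, hx, hxA⟩)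
      have hA : A.Nonempty := (key _ F.univ_mem).mono inter_subset_right
      let G : Upfamily X := ⟨F.1 ∪ {B | A ⊆ B}, ⟨univ, Or.inr (subset_univ _)⟩, by
        rintro B (hB | hB)
        · exact F.nonempty_of_mem hB
        · exact hA.mono hB, by
        rintro B (hB | hB) C hBC
        · exact Or.inl (F.mono hB hBC)
        · exact Or.inr (hB.trans hBC)⟩
      have hG : G.Linked := by
        rintro B (hB | hB) C (hC | hC)
        · exact hl B hB C hC
        · exact (key B hB).mono (inter_subset_inter_right _ hC)
        · rw [inter_comm]
          exact (key C hC).mono (inter_subset_inter_right _ hB)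
        · exact hA.mono (subset_inter hB hC)
      have := hm G hG subset_union_left
      exact h (this ▸ (Or.inr Subset.rfl : A ∈ G.1))
  · intro h
    refine ⟨fun A hA B hB => ?_, fun G hG hFG => ext fun A => ⟨fun hA => hFG hA, fun hA => ?_⟩⟩
    · by_contra hAB
      exact (h B).1 (F.mono hA fun x hx hxB => hAB ⟨x, hx, hxB⟩) hB
    · by_contra hAF
      simpa using hG A hA _ (hFG ((h A).2 hAF))

theorem lambdaS_mul [Mul X] {F G : Upfamily X} (hF : F ∈ lambdaS X) (hG : G ∈ lambdaS X) :
    F * G ∈ lambdaS X := by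
  rw [mem_lambdaS] at *
  intro C
  rw [mem_mul, mem_mul, ← hF]
  have : {x | {y | x * y ∈ Cᶜ} ∈ G.1} = {x | {y | x * y ∈ C} ∈ G.1}ᶜ := by
    ext x
    exact hG {y | x * y ∈ C}
  rw [this]

theorem linked_of_mem_lambdaS {F : Upfamily X} (hF : F ∈ lambdaS X) : F ∈ N2S X := hF.1

/-- Two maximal linked upfamilies coincide as soon as one contains the other. -/
theorem eq_of_subset {F G : Upfamily X} (hF : F ∈ lambdaS X) (hG : G ∈ lambdaS X)
    (h : F.1 ⊆ G.1) : F = G := hF.2 G hG.1 h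

/-- The upfamily of a monotone self-dual property of sets. -/
def ofSelfDual (P : Set X → Prop) (mono : ∀ A B, A ⊆ B → P A → P B)
    (dual : ∀ A, P Aᶜ ↔ ¬ P A) : Upfamily X :=
  ⟨{A | P A}, by
    have huniv : P univ := by
      by_contra h
      exact h (mono _ _ (subset_univ _) ((dual univ).2 h))
    refine ⟨⟨univ, huniv⟩, fun A hA => ?_, fun A hA B hAB => mono A B hAB hA⟩
    rcases A.eq_empty_or_nonempty with rfl | h
    · exact absurd hA ((dual ∅).1 (by simpa using huniv))
    · exact h⟩

theorem ofSelfDual_mem_lambdaS (P : Set X → Prop) (mono : ∀ A B, A ⊆ B → P A → P B)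
    (dual : ∀ A, P Aᶜ ↔ ¬ P A) : ofSelfDual P mono dual ∈ lambdaS X :=
  mem_lambdaS.2 dual

/-- The pushforward of an upfamily. -/
def map (f : X → Y) (F : Upfamily X) : Upfamily Y :=
  ⟨{A | f ⁻¹' A ∈ F.1}, ⟨univ, F.univ_mem⟩, fun _ hA =>
    let ⟨x, hx⟩ := F.nonempty_of_mem hA
    ⟨f x, hx⟩, fun _ hA _ hAB => F.mono hA (preimage_mono hAB)⟩

theorem mem_map {f : X → Y} {F : Upfamily X} {A : Set Y} : A ∈ (map f F).1 ↔ f ⁻¹' A ∈ F.1 :=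
  Iff.rfl

theorem map_mem_lambdaS (f : X → Y) {F : Upfamily X} (hF : F ∈ lambdaS X) :
    map f F ∈ lambdaS Y :=
  mem_lambdaS.2 fun A => mem_lambdaS.1 hF (f ⁻¹' A)

theorem map_mul [Mul X] [Mul Y] (f : X → Y) (hf : ∀ x y, f (x * y) = f x * f y)
    (F G : Upfamily X) : map f (F * G) = map f F * map f G := ext fun C => by
  simp only [mem_mul, mem_map, preimage_ofPred_eq, mem_preimage, hf]

theorem map_injective {f : X → Y} (hf : Function.Injective f) :
    Function.Injective (map f) := fun F G h => ext fun A => by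
  have := congrArg (fun H : Upfamily Y => f '' A ∈ H.1) h
  simpa [mem_map, hf.preimage_image] using this

theorem mem_principal {x : X} {A : Set X} : A ∈ (principal x).1 ↔ x ∈ A := Iff.rfl

theorem principal_mem_lambdaS (x : X) : principal x ∈ lambdaS X :=
  mem_lambdaS.2 fun _ => Iff.rfl

theorem principal_mul [Mul X] (x y : X) : principal x * principal y = principal (x * y) :=
  ext fun C => by simp [mem_mul, mem_principal]

theorem principal_injective : Function.Injective (principal : X → Upfamily X) := fun x y h => by
  have : ({y} : Set X) ∈ (principal x).1 := h ▸ (mem_singleton y : y ∈ ({y} : Set X))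
  exact this

/-- A maximal linked upfamily containing a singleton is principal. -/
theorem eq_principal_of_singleton_mem {F : Upfamily X} (hF : F ∈ lambdaS X) {x : X}
    (hx : {x} ∈ F.1) : F = principal x :=
  (eq_of_subset (principal_mem_lambdaS x) hF fun _ hA =>
    F.mono hx (singleton_subset_iff.2 hA)).symm

end Upfamily

section GeneralSemigroup

variable {M : Type*} [Semigroup M]

theorem ppow_mul_ppow (a : M) (m n : ℕ) : ppow a m * ppow a n = ppow a (m + n + 1) := by
  induction n with
  | zero => rfl
  | succ n ih =>
    change ppow a m * (ppow a n * a) = ppow a (m + n + 1) * a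
    rw [← mul_assoc, ih]

theorem ppow_add_mul {a : M} {d : ℕ} (h : ppow a d = a) (n k : ℕ) :
    ppow a (n + d * k) = ppow a n := by
  have step : ∀ n, ppow a (n + d) = ppow a n := by
    rintro (_ | n)
    · rw [zero_add]; exact h
    · rw [show n + 1 + d = n + d + 1 by ring, ← ppow_mul_ppow a n d, h]
      rfl
  induction k with
  | zero => rfl
  | succ k ih => rw [mul_add, mul_one, ← add_assoc, step, ih]

/-- An element that equals one of its higher powers lies in the group formed by its powers. -/
theorem isSubgroupIn_range_ppow {a : M} {d : ℕ} (h : ppow a (d + 1) = a) :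
    IsSubgroupIn (range (ppow a)) := by
  refine ⟨?_, ppow a d, ⟨d, rfl⟩, ?_, ?_⟩
  · rintro _ ⟨m, rfl⟩ _ ⟨n, rfl⟩
    exact ⟨_, (ppow_mul_ppow a m n).symm⟩
  · rintro _ ⟨n, rfl⟩
    rw [ppow_mul_ppow, ppow_mul_ppow]
    have := ppow_add_mul h n 1
    constructor <;> rw [← this] <;> congr 1 <;> ring
  · rintro _ ⟨n, rfl⟩
    refine ⟨ppow a (d * (n + 1) + d), ⟨_, rfl⟩, ?_⟩
    rw [ppow_mul_ppow, ppow_mul_ppow, ← ppow_add_mul h d (n + 1)]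
    constructor <;> congr 1 <;> ring

theorem inverseOn_of_commOn_of_cliffordOn {S : Set M} (hc : commOn S)
    (hC : cliffordOn S) : inverseOn S := by
  intro a ha
  obtain ⟨H, hHS, ⟨-, e, he, hid, hinv⟩, haH⟩ := hC a ha
  obtain ⟨b, hb, hab, hba⟩ := hinv a haH
  refine ⟨b, ⟨hHS hb, ?_, ?_⟩, ?_⟩
  · rw [hab, (hid a haH).1]
  · rw [hba, (hid b hb).1]
  · rintro c ⟨hcS, haca, hcac⟩
    have hbS := hHS hb
    have hca : c * a = e := by
      calc c * a = c * (a * e) := by rw [(hid a haH).2]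
        _ = (c * a) * (a * b) := by rw [hab, mul_assoc]
        _ = (a * c) * (a * b) := by rw [hc c hcS a ha]
        _ = (a * c * a) * b := by simp only [mul_assoc]
        _ = e := by rw [haca, hab]
    calc c = c * a * c := hcac.symm
      _ = c * (a * c) := mul_assoc _ _ _
      _ = c * (a * b) := by rw [hc a ha c hcS, hca, hab]
      _ = e * b := by rw [← mul_assoc, hca]
      _ = b := (hid b hb).1

theorem idemCommOn_of_inverseOn {S : Set M} (hS : mulClosed S) (hI : inverseOn S) :
    idemCommOn S := by
  have idem : ∀ e ∈ S, ∀ f ∈ S, e * e = e → f * f = f → e * f * (e * f) = e * f := by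
    intro e he f hf hee hff
    obtain ⟨x, ⟨hx, h1, h2⟩, huniq⟩ := hI (e * f) (hS e he f hf)
    have hfxe : f * x * e = x := by
      refine huniq _ ⟨hS _ (hS _ hf _ hx) _ he, ?_, ?_⟩
      · calc e * f * (f * x * e) * (e * f) = e * (f * f) * x * (e * e) * f := by
              simp only [mul_assoc]
          _ = e * f * x * (e * f) := by rw [hee, hff]; simp only [mul_assoc]
          _ = e * f := h1
      · calc f * x * e * (e * f) * (f * x * e) = f * x * (e * e) * (f * f) * x * e := by
              simp only [mul_assoc]
          _ = f * (x * (e * f) * x) * e := by rw [hee, hff]; simp only [mul_assoc]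
          _ = f * x * e := by rw [h2]
    have hxx : x * x = x := by
      calc x * x = f * x * e * (f * x * e) := by rw [hfxe]
        _ = f * (x * (e * f) * x) * e := by simp only [mul_assoc]
        _ = x := by rw [h2, hfxe]
    obtain ⟨y, -, huniq'⟩ := hI x hx
    have e1 : x = y := huniq' x ⟨hx, by rw [hxx, hxx], by rw [hxx, hxx]⟩
    have e2 : e * f = y := huniq' _ ⟨hS e he f hf, h2, h1⟩
    rw [e2, ← e1, hxx]
  intro e he f hf hee hff
  have h1 := idem e he f hf hee hff
  have h2 := idem f hf e he hff hee
  obtain ⟨y, -, huniq⟩ := hI (e * f) (hS e he f hf)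
  have e1 : e * f = y := huniq _ ⟨hS e he f hf, by rw [h1, h1], by rw [h1, h1]⟩
  have e2 : f * e = y := by
    refine huniq _ ⟨hS f hf e he, ?_, ?_⟩
    · calc e * f * (f * e) * (e * f) = e * (f * f) * (e * e) * f := by simp only [mul_assoc]
        _ = e * f := by rw [hff, hee, mul_assoc, h1]
    · calc f * e * (e * f) * (f * e) = f * (e * e) * (f * f) * e := by simp only [mul_assoc]
        _ = f * e := by rw [hff, hee, mul_assoc, h2]
  rw [e1, e2]

end GeneralSemigroup

/-- The superextension is commutative and satisfies the identity `x ^ 13 = x`. -/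
def SuperextensionCommPeriodic (X : Type*) [Mul X] : Prop :=
  commOn (lambdaS X) ∧ ∀ F ∈ lambdaS X, ppow F 12 = F

theorem ppow_eq_self_of_idem {M : Type*} [Mul M] {a : M} (h : a * a = a) (n : ℕ) :
    ppow a n = a := by
  induction n with
  | zero => rfl
  | succ n ih => rw [ppow, ih, h]

theorem map_ppow {M N : Type*} [Mul M] [Mul N] {f : M → N} (hf : ∀ a b, f (a * b) = f a * f b)
    (a : M) (n : ℕ) : f (ppow a n) = ppow (f a) n := by
  induction n with
  | zero => rfl
  | succ n ih => rw [ppow, hf, ih, ppow]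

namespace SuperextensionCommPeriodic

variable {X Y : Type*}

theorem of_injective [Mul X] [Mul Y] (f : X → Y) (hf : Function.Injective f)
    (hmul : ∀ x y, f (x * y) = f x * f y) (h : SuperextensionCommPeriodic Y) :
    SuperextensionCommPeriodic X := by
  have hm := Upfamily.map_mul f hmul
  constructor
  · intro F hF G hG
    apply Upfamily.map_injective hf
    rw [hm, hm, h.1 _ (Upfamily.map_mem_lambdaS f hF) _ (Upfamily.map_mem_lambdaS f hG)]
  · intro F hF
    apply Upfamily.map_injective hf
    rw [map_ppow hm, h.2 _ (Upfamily.map_mem_lambdaS f hF)]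

theorem of_mulEquiv [Mul X] [Mul Y] (h : SuperextensionCommPeriodic Y) :
    Nonempty (X ≃* Y) → SuperextensionCommPeriodic X :=
  fun ⟨e⟩ => h.of_injective e e.injective (map_mul e)

theorem cliffordOn [Semigroup X] (h : SuperextensionCommPeriodic X) :
    cliffordOn (lambdaS X) := by
  intro F hF
  refine ⟨range (ppow F), ?_, isSubgroupIn_range_ppow (h.2 F hF), 0, rfl⟩
  rintro _ ⟨n, rfl⟩
  induction n with
  | zero => exact hF
  | succ n ih => exact Upfamily.lambdaS_mul ih hF

end SuperextensionCommPeriodic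

/-- If the operation of a finite commutative `X` is the minimum with respect to a rank function,
except that the square of the bottom element `s` is arbitrary subject to `s ^ 3 = s`,
then the superextension is commutative and satisfies `x ^ 13 = x`. -/
theorem superextensionCommPeriodic_of_rank {X : Type*} [Mul X] [Finite X] (r : X → ℕ)
    (hr : Function.Injective r) (s : X) (hs : ∀ x, r s ≤ r x) (hsss : s * s * s = s)
    (hcomm : ∀ x y : X, x * y = y * x)
    (hmul : ∀ x y : X, x ≠ s → r x ≤ r y → x * y = x)
    (hmul' : ∀ x : X, x ≠ s → s * x = s) :
    SuperextensionCommPeriodic X := by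
  have min_cases : ∀ x y : X, x ≠ s → (x * y = x ∧ r x ≤ r y) ∨ (x * y = y ∧ r y ≤ r x) := by
    intro x y hx
    rcases le_total (r x) (r y) with h | h
    · exact Or.inl ⟨hmul x y hx h, h⟩
    · right
      refine ⟨?_, h⟩
      by_cases hy : y = s
      · rw [hy, hcomm, hmul' x hx]
      · rw [hcomm, hmul y x hy h]
  have strict : ∀ x y : X, r x ≤ r y → x ≠ y → r x < r y := fun x y h hne =>
    lt_of_le_of_ne h fun h' => hne (hr h')
  have key : ∀ F ∈ lambdaS X, ∀ G ∈ lambdaS X, {s} ∉ F.1 → {s} ∉ G.1 → F * G = G * F := by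
    intro F hF G hG hsF hsG
    refine Upfamily.eq_of_subset (Upfamily.lambdaS_mul hF hG) (Upfamily.lambdaS_mul hG hF) ?_
    intro C hC
    by_contra hC'
    rw [Upfamily.mem_mul] at hC hC'
    rw [← Upfamily.mem_lambdaS.1 hG] at hC'
    set A : Set X := {x | {y | x * y ∈ C} ∈ G.1} with hA
    set B : Set X := {x | {y | x * y ∈ C} ∈ F.1}ᶜ with hB
    have hAB : ∀ a ∈ A, ∃ b ∈ B, a * b ∈ C := fun a ha =>
      let ⟨b, h1, h2⟩ := hG.1 _ ha _ hC'
      ⟨b, h2, h1⟩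
    have hBA : ∀ b ∈ B, ∃ a ∈ A, b * a ∉ C := fun b hb =>
      let ⟨a, h1, h2⟩ := hF.1 _ ((Upfamily.mem_lambdaS.1 hF {y | b * y ∈ C}).2 hb) _ hC
      ⟨a, h2, h1⟩
    have claim : ∀ n, ∀ a, r a = n → (a ∈ A → a ∈ C) ∧ (a ∈ B → a ∉ C) := by
      intro n
      induction n using Nat.strong_induction_on with
      | _ n ih =>
        rintro a rfl
        by_cases has : a = s
        · subst has
          refine ⟨fun ha => ?_, fun ha => ?_⟩
          · by_contra hc
            refine hsG (G.mono ha fun y hy => ?_)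
            by_contra hya
            exact hc (hmul' y hya ▸ hy)
          · intro hc
            refine hsF (F.mono ((Upfamily.mem_lambdaS.1 hF {y | a * y ∈ C}).2 ha) fun y hy => ?_)
            by_contra hya
            exact hy (show a * y ∈ C by rwa [hmul' y hya])
        · refine ⟨fun ha => ?_, fun ha => ?_⟩
          · by_contra hc
            obtain ⟨b, hb, hab⟩ := hAB a ha
            rcases min_cases a b has with ⟨h, -⟩ | ⟨h, hle⟩
            · exact hc (h ▸ hab)
            · rw [h] at hab
              exact (ih (r b) (strict b a hle fun h' => hc (h' ▸ hab)) b rfl).2 hb hab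
          · intro hc
            obtain ⟨b, hb, hab⟩ := hBA a ha
            rcases min_cases a b has with ⟨h, -⟩ | ⟨h, hle⟩
            · exact hab (by rwa [h])
            · rw [h] at hab
              exact hab ((ih (r b) (strict b a hle fun h' => hab (h' ▸ hc)) b rfl).1 hb)
    have upA : ∀ a ∈ A, a ≠ s → ∃ b ∈ B, r a < r b := by
      intro a ha has
      obtain ⟨b, hb, hab⟩ := hAB a ha
      have hbC := (claim _ b rfl).2 hb
      rcases min_cases a b has with ⟨h, hle⟩ | ⟨h, -⟩
      · exact ⟨b, hb, strict a b hle fun h' => hbC (h' ▸ (claim _ a rfl).1 ha)⟩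
      · exact absurd (h ▸ hab) hbC
    have upB : ∀ b ∈ B, b ≠ s → ∃ a ∈ A, r b < r a := by
      intro b hb hbs
      obtain ⟨a, ha, hab⟩ := hBA b hb
      have haC := (claim _ a rfl).1 ha
      rcases min_cases b a hbs with ⟨h, hle⟩ | ⟨h, -⟩
      · exact ⟨a, ha, strict b a hle fun h' => (claim _ b rfl).2 hb (h' ▸ haC)⟩
      · exact absurd haC (h ▸ hab)
    have hne : {x | x ∈ A ∪ B ∧ x ≠ s}.Nonempty := by
      by_contra h
      refine hsF (F.mono hC fun x hx => ?_)
      by_contra hxs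
      exact h ⟨x, Or.inl hx, hxs⟩
    obtain ⟨m, ⟨hm, hms⟩, hmax⟩ := Set.exists_max_image _ r (Set.toFinite _) hne
    have : ∃ x ∈ A ∪ B, r m < r x := by
      rcases hm with hm | hm
      · obtain ⟨b, hb, h⟩ := upA m hm hms
        exact ⟨b, Or.inr hb, h⟩
      · obtain ⟨a, ha, h⟩ := upB m hm hms
        exact ⟨a, Or.inl ha, h⟩
    obtain ⟨x, hx, hlt⟩ := this
    refine absurd (hmax x ⟨hx, ?_⟩) (not_le.2 hlt)
    rintro rfl
    exact absurd (hs m) (not_le.2 hlt)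
  have idem : ∀ F ∈ lambdaS X, {s} ∉ F.1 → F * F = F := by
    intro F hF hsF
    refine (Upfamily.eq_of_subset hF (Upfamily.lambdaS_mul hF hF) ?_).symm
    intro C hC
    rw [Upfamily.mem_mul]
    refine F.mono hC fun x hx => ?_
    by_cases hxs : x = s
    · subst hxs
      refine F.mono ((Upfamily.mem_lambdaS.1 hF {x}).2 hsF) fun y hy => ?_
      rw [mem_ofPred_eq, hmul' y hy]
      exact hx
    · refine F.mono hC fun y hy => ?_
      rcases min_cases x y hxs with ⟨h, -⟩ | ⟨h, -⟩
      · rwa [mem_ofPred_eq, h]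
      · rwa [mem_ofPred_eq, h]
  have pcomm : ∀ F : Upfamily X, Upfamily.principal s * F = F * Upfamily.principal s := by
    intro F
    refine Upfamily.ext fun C => ?_
    rw [Upfamily.mem_mul, Upfamily.mem_mul, Upfamily.mem_principal]
    simp only [Upfamily.mem_principal, mem_ofPred_eq, hcomm s]
  constructor
  · intro F hF G hG
    by_cases hsF : {s} ∈ F.1
    · rw [Upfamily.eq_principal_of_singleton_mem hF hsF, pcomm]
    by_cases hsG : {s} ∈ G.1
    · rw [Upfamily.eq_principal_of_singleton_mem hG hsG, pcomm]
    exact key F hF G hG hsF hsG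
  · intro F hF
    by_cases hsF : {s} ∈ F.1
    · rw [Upfamily.eq_principal_of_singleton_mem hF hsF,
        ← map_ppow (f := Upfamily.principal) (fun a b => (Upfamily.principal_mul a b).symm)]
      simp only [ppow, hsss]
    · exact ppow_eq_self_of_idem (idem F hF hsF) 12

theorem superextensionCommPeriodic_osum (n : ℕ) :
    SuperextensionCommPeriodic (OSum (Cgrp 2) (L n)) := by
  have : Finite (L n) := inferInstanceAs (Finite (Fin n))
  let r : OSum (Cgrp 2) (L n) → ℕ :=
    Sum.elim (fun g => if g = 1 then 1 else 0) (fun i => Fin.val (n := n) i + 2)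
  have r_inl : ∀ g, r (Sum.inl g) = if g = 1 then 1 else 0 := fun _ => rfl
  have r_inr : ∀ i, r (Sum.inr i) = Fin.val (n := n) i + 2 := fun _ => rfl
  have hC : ∀ g h : Cgrp 2, g ≠ 1 → h ≠ 1 → g = h := by decide
  refine superextensionCommPeriodic_of_rank r ?_ (Sum.inl (Multiplicative.ofAdd 1)) ?_ rfl ?_ ?_ ?_
  · rintro (g | i) (h | j) H
    · by_cases hg : g = 1 <;> by_cases hh : h = 1 <;> simp only [r_inl, hg, hh, if_true, if_false,
        one_ne_zero, zero_ne_one] at H ⊢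
      rw [hC g h hg hh]
    · simp only [r_inl, r_inr] at H
      split_ifs at H
      all_goals omega
    · simp only [r_inl, r_inr] at H
      split_ifs at H
      all_goals omega
    · simp only [r_inr, add_left_inj] at H
      exact congrArg Sum.inr (Fin.ext H)
  · intro x
    exact Nat.zero_le _
  · rintro (g | i) (h | j)
    · exact congrArg Sum.inl (mul_comm g h)
    · rfl
    · rfl
    · exact congrArg Sum.inr (min_comm (α := Fin n) i j)
  · rintro (g | i) (h | j) hx hle
    · have hg : g = 1 := by
        by_contra hg
        exact hx (congrArg Sum.inl (hC _ _ hg (by decide)))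
      have hh : h = 1 := by
        by_contra hh
        simp [r_inl, hg, hh] at hle
      subst hg hh
      rfl
    · rfl
    · simp only [r_inl, r_inr] at hle
      split_ifs at hle <;> omega
    · simp only [r_inr, add_le_add_iff_right] at hle
      exact congrArg Sum.inr (min_eq_left (α := Fin n) hle)
  · rintro (g | i) hx
    · have hg : g = 1 := by
        by_contra hg
        exact hx (congrArg Sum.inl (hC _ _ hg (by decide)))
      subst hg
      rfl
    · rfl

theorem superextensionCommPeriodic_linear (n : ℕ) : SuperextensionCommPeriodic (L n) :=
  (superextensionCommPeriodic_osum n).of_injective Sum.inr Sum.inr_injective fun _ _ => rfl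

/-- The value at the set with characteristic number `s` of the self-dual family on `Fin (m + 1)`
whose members containing `0` are listed by the bits of `a`. -/
def selfDualVal (m a s : ℕ) : Bool :=
  if s % 2 = 1 then a.testBit (s / 2) else !a.testBit ((2 ^ (m + 1) - (s + 1)) / 2)

/-- Monotonicity of the self-dual family with number `a`. -/
def selfDualMono (m a : ℕ) : Bool :=
  (List.range (2 ^ (m + 1))).all fun s =>
    !selfDualVal m a s || (List.range (m + 1)).all fun i => selfDualVal m a (s ||| 2 ^ i)

/-- The product of self-dual families in terms of their numbers. -/
def selfDualMul (m : ℕ) (mt : Fin (m + 1) → Fin (m + 1) → Fin (m + 1)) (a b : ℕ) : ℕ :=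
  Nat.ofBits fun k : Fin (2 ^ m) => selfDualVal m a <| Nat.ofBits fun x =>
    selfDualVal m b <| Nat.ofBits fun y => (2 * k.val + 1).testBit (mt x y)

/-- The thirteenth power of every maximal linked upfamily on `Fin (m + 1)` is itself, and
such upfamilies commute. -/
def superextensionCheck (m : ℕ) (mt : Fin (m + 1) → Fin (m + 1) → Fin (m + 1)) : Bool :=
  let l := (List.range (2 ^ 2 ^ m)).filter (selfDualMono m)
  l.all fun a => (l.all fun b => selfDualMul m mt a b == selfDualMul m mt b a) &&
    (let b := selfDualMul m mt a a
     let c := selfDualMul m mt b a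
     let d := selfDualMul m mt c c
     selfDualMul m mt (selfDualMul m mt d d) a == a)

section

variable {X : Type*} {m : ℕ} (e : X ≃ Fin (m + 1))

/-- The set with a given characteristic number. -/
def setOfBits (s : ℕ) : Set X := {x | s.testBit (e x)}

open Classical in
/-- The number of an upfamily on a finite set. -/
noncomputable def Upfamily.number (F : Upfamily X) : ℕ :=
  Nat.ofBits fun k : Fin (2 ^ m) => decide (setOfBits e (2 * k.val + 1) ∈ F.1)

theorem setOfBits_ofBits (f : Fin (m + 1) → Bool) :
    setOfBits e (Nat.ofBits f) = {x | f (e x)} := by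
  ext x
  simp [setOfBits, Nat.testBit_ofBits_lt f (e x) (e x).2]

theorem exists_setOfBits (A : Set X) : ∃ s < 2 ^ (m + 1), setOfBits e s = A := by
  classical
  refine ⟨Nat.ofBits fun i => decide (e.symm i ∈ A), Nat.ofBits_lt_two_pow _, ?_⟩
  rw [setOfBits_ofBits]
  simp

open Classical in
theorem selfDualVal_number {F : Upfamily X} (hF : F ∈ lambdaS X) {s : ℕ} (hs : s < 2 ^ (m + 1)) :
    selfDualVal m (F.number e) s = decide (setOfBits e s ∈ F.1) := by
  have odd : ∀ t, t % 2 = 1 → t < 2 ^ (m + 1) →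
      (F.number e).testBit (t / 2) = decide (setOfBits e t ∈ F.1) := by
    intro t ht hlt
    have h : t / 2 < 2 ^ m := by rw [pow_succ] at hlt; omega
    rw [Upfamily.number, Nat.testBit_ofBits_lt _ _ h]
    simp only [show 2 * (t / 2) + 1 = t by omega]
  unfold selfDualVal
  split_ifs with h
  · exact odd s h hs
  · rw [odd _ (by rw [pow_succ] at *; omega) (by omega)]
    have : setOfBits e (2 ^ (m + 1) - (s + 1)) = (setOfBits e s)ᶜ := by
      ext x
      simpa [setOfBits, Nat.testBit_two_pow_sub_succ hs] using fun _ => Nat.le_of_lt_succ (e x).2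
    simp [this, Upfamily.mem_lambdaS.1 hF]

theorem number_lt (F : Upfamily X) : F.number e < 2 ^ 2 ^ m := Nat.ofBits_lt_two_pow _

theorem number_injOn {F G : Upfamily X} (hF : F ∈ lambdaS X) (hG : G ∈ lambdaS X)
    (h : F.number e = G.number e) : F = G := by
  classical
  refine Upfamily.ext fun A => ?_
  obtain ⟨s, hs, rfl⟩ := exists_setOfBits e A
  have := selfDualVal_number e hF hs
  rw [h, selfDualVal_number e hG hs] at this
  simpa using this.symm

theorem selfDualMono_number {F : Upfamily X} (hF : F ∈ lambdaS X) :
    selfDualMono m (F.number e) := by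
  classical
  rw [selfDualMono, List.all_eq_true]
  intro s hs
  rw [List.mem_range] at hs
  rw [selfDualVal_number e hF hs, Bool.or_eq_true, List.all_eq_true]
  by_cases h : setOfBits e s ∈ F.1
  · right
    intro i hi
    rw [List.mem_range] at hi
    rw [selfDualVal_number e hF (Nat.or_lt_two_pow hs (Nat.pow_lt_pow_right (by omega) hi))]
    refine decide_eq_true (F.mono h fun x hx => ?_)
    simp only [setOfBits, mem_ofPred_eq, Nat.testBit_or] at hx ⊢
    simp [hx]
  · left
    simp [h]

theorem selfDualMul_number [Mul X] {mt : Fin (m + 1) → Fin (m + 1) → Fin (m + 1)}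
    (hmt : ∀ x y, e (x * y) = mt (e x) (e y)) {F G : Upfamily X} (hF : F ∈ lambdaS X)
    (hG : G ∈ lambdaS X) :
    selfDualMul m mt (F.number e) (G.number e) = (F * G).number e := by
  classical
  unfold selfDualMul
  conv_rhs => unfold Upfamily.number
  congr 1
  funext k
  rw [selfDualVal_number e hF (Nat.ofBits_lt_two_pow _), setOfBits_ofBits, decide_eq_decide,
    Upfamily.mem_mul]
  have : ∀ x, selfDualVal m (G.number e)
      (Nat.ofBits fun y => (2 * k.val + 1).testBit (mt (e x) y)) =
      decide ({y | x * y ∈ setOfBits e (2 * k.val + 1)} ∈ G.1) := by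
    intro x
    rw [selfDualVal_number e hG (Nat.ofBits_lt_two_pow _), setOfBits_ofBits]
    simp only [← hmt]
    rfl
  simp only [this, decide_eq_true_eq]

theorem superextensionCommPeriodic_of_check [Semigroup X]
    (h : superextensionCheck m fun i j => e (e.symm i * e.symm j)) :
    SuperextensionCommPeriodic X := by
  unfold superextensionCheck at h
  simp only [List.all_eq_true, List.mem_filter, List.mem_range, Bool.and_eq_true, beq_iff_eq,
    and_imp] at h
  have H := fun F (hF : F ∈ lambdaS X) => h _ (number_lt e F) (selfDualMono_number e hF)
  have hm := fun {F G : Upfamily X} => selfDualMul_number e (F := F) (G := G)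
    (mt := fun i j => e (e.symm i * e.symm j)) (fun x y => by simp)
  constructor
  · intro F hF G hG
    have := (H F hF).1 _ (number_lt e G) (selfDualMono_number e hG)
    rw [hm hF hG, hm hG hF] at this
    exact number_injOn e (Upfamily.lambdaS_mul hF hG) (Upfamily.lambdaS_mul hG hF) this
  · intro F hF
    have h2 := Upfamily.lambdaS_mul hF hF
    have h3 := Upfamily.lambdaS_mul h2 hF
    have h6 := Upfamily.lambdaS_mul h3 h3
    have h12 := Upfamily.lambdaS_mul h6 h6
    have := (H F hF).2
    rw [hm hF hF, hm h2 hF, hm h3 h3, hm h6 h6, hm h12 hF] at this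
    have := number_injOn e (Upfamily.lambdaS_mul h12 hF) hF this
    simpa only [ppow, mul_assoc] using this

end

theorem superextensionCommPeriodic_cyclic_three : SuperextensionCommPeriodic (Cgrp 3) :=
  superextensionCommPeriodic_of_check (m := 2) (Multiplicative.toAdd (α := ZMod 3))
    (by decide +kernel)

theorem superextensionCommPeriodic_cyclic_four : SuperextensionCommPeriodic (Cgrp 4) :=
  superextensionCommPeriodic_of_check (m := 3) (Multiplicative.toAdd (α := ZMod 4))
    (by decide +kernel)

theorem superextensionCommPeriodic_prod_cyclic_two :
    SuperextensionCommPeriodic (Cgrp 2 × Cgrp 2) :=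
  superextensionCommPeriodic_of_check (X := Cgrp 2 × Cgrp 2) (m := 3)
    (finProdFinEquiv (m := 2) (n := 2))
    (by decide +kernel)

instance (n : ℕ) : Semigroup (L n) where
  mul_assoc a b c := min_assoc (α := Fin n) a b c

instance {A B : Type*} [Semigroup A] [Semigroup B] : Semigroup (OSum A B) where
  mul_assoc := by
    rintro (a | a) (b | b) (c | c)
    · exact congrArg Sum.inl (mul_assoc a b c)
    all_goals first | rfl | exact congrArg Sum.inr (mul_assoc a b c)

theorem superextensionCommPeriodic_linear_prod_cyclic :
    SuperextensionCommPeriodic (L 2 × Cgrp 2) :=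
  superextensionCommPeriodic_of_check (X := L 2 × Cgrp 2) (m := 3)
    (finProdFinEquiv (m := 2) (n := 2))
    (by decide +kernel)

theorem superextensionCommPeriodic_one_osum :
    SuperextensionCommPeriodic (OSum (L 1) (Cgrp 2)) :=
  superextensionCommPeriodic_of_check (X := OSum (L 1) (Cgrp 2)) (m := 2)
    (finSumFinEquiv (m := 1) (n := 2))
    (by decide +kernel)

theorem superextensionCommPeriodic_cyclic_two : SuperextensionCommPeriodic (Cgrp 2) :=
  (superextensionCommPeriodic_osum 0).of_injective Sum.inl Sum.inl_injective fun _ _ => rfl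

namespace Upfamily

variable {X : Type*}

/-- An ultrafilter as an upfamily. -/
def ofUltrafilter (U : Ultrafilter X) : Upfamily X :=
  ⟨{A | A ∈ U}, ⟨univ, Filter.univ_mem⟩, fun _ hA => U.nonempty_of_mem hA,
    fun _ hA _ hAB => Filter.mem_of_superset hA hAB⟩

theorem ofUltrafilter_mem_lambdaS (U : Ultrafilter X) : ofUltrafilter U ∈ lambdaS X :=
  mem_lambdaS.2 fun _ => Ultrafilter.compl_mem_iff_notMem

end Upfamily

theorem idemCommOn.of_injective {X Y : Type*} [Mul X] [Mul Y] {f : Y → X}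
    (hf : Function.Injective f) (hmul : ∀ x y, f (x * y) = f x * f y)
    (h : idemCommOn (lambdaS X)) : idemCommOn (lambdaS Y) := by
  intro F hF G hG hFF hGG
  apply Upfamily.map_injective hf
  have hm := Upfamily.map_mul f hmul
  rw [hm, hm]
  exact h _ (Upfamily.map_mem_lambdaS f hF) _ (Upfamily.map_mem_lambdaS f hG)
    (by rw [← hm, hFF]) (by rw [← hm, hGG])

section

attribute [local instance] Ultrafilter.mul Ultrafilter.semigroup

theorem Upfamily.ofUltrafilter_mul {X : Type*} [Mul X] (U V : Ultrafilter X) :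
    ofUltrafilter (U * V) = ofUltrafilter U * ofUltrafilter V :=
  ext fun C => by
    rw [mem_mul]
    exact Ultrafilter.eventually_mul U V (· ∈ C)

/-- Every idempotent ultrafilter on the additive semigroup of positive integers contains
the multiples of every positive integer. -/
theorem eventually_dvd_of_idempotent {U : Ultrafilter (Multiplicative ℕ+)} (hU : U * U = U)
    (N : ℕ) [NeZero N] : ∀ᶠ n : Multiplicative ℕ+ in U, N ∣ (n.toAdd : ℕ) := by
  obtain ⟨r, hr⟩ := (U.map fun n : Multiplicative ℕ+ => ((n.toAdd : ℕ) : ZMod N)).eq_pure_of_finite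
  have h : ∀ᶠ n : Multiplicative ℕ+ in U, ((n.toAdd : ℕ) : ZMod N) = r := by
    have : {r} ∈ U.map fun n : Multiplicative ℕ+ => ((n.toAdd : ℕ) : ZMod N) := hr ▸ mem_singleton r
    exact this
  have h2 := h
  rw [← hU, Ultrafilter.eventually_mul] at h2
  obtain ⟨m, hm, h3⟩ := (h.and h2).exists
  obtain ⟨n, hn, h4⟩ := (h.and h3).exists
  have hr0 : r = 0 := by
    rw [toAdd_mul, PNat.add_coe, Nat.cast_add, hm, hn] at h4
    simpa using h4
  filter_upwards [h] with n hn
  rwa [hr0, ZMod.natCast_eq_zero_iff] at hn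

/-- There are idempotent ultrafilters concentrated on numbers of the form `c * 4 ^ i * (odd)`. -/
theorem exists_idempotent_four_pow (c : ℕ+) :
    ∃ U : Ultrafilter (Multiplicative ℕ+), U * U = U ∧
      ∀ᶠ n : Multiplicative ℕ+ in U, ∃ i q : ℕ, (n.toAdd : ℕ) = c * (4 ^ i * (2 * q + 1)) := by
  obtain ⟨U, hU, h⟩ := Hindman.exists_idempotent_ultrafilter_le_FP
    (fun i => Multiplicative.ofAdd (c * 4 ^ i) : Stream' (Multiplicative ℕ+))
  refine ⟨U, hU, h.mono fun n hn => ?_⟩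
  have key : ∀ (a : Stream' (Multiplicative ℕ+)) (n : Multiplicative ℕ+), n ∈ Hindman.FP a →
      ∀ j, (∀ i, a.get i = Multiplicative.ofAdd (c * 4 ^ (i + j))) →
      ∃ i q : ℕ, j ≤ i ∧ (n.toAdd : ℕ) = c * (4 ^ i * (2 * q + 1)) := by
    intro a n hn
    induction hn with
    | head' a =>
      intro j ha
      refine ⟨j, 0, le_rfl, ?_⟩
      have : a.head = _ := ha 0
      rw [this]
      simp
    | tail' a m _ ih =>
      intro j ha
      obtain ⟨i, q, hi, h⟩ := ih (j + 1) fun i => by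
        rw [← add_assoc, add_right_comm]
        exact ha (i + 1)
      exact ⟨i, q, by omega, h⟩
    | cons' a m _ ih =>
      intro j ha
      obtain ⟨i, q, hi, h⟩ := ih (j + 1) fun i => by
        rw [← add_assoc, add_right_comm]
        exact ha (i + 1)
      obtain ⟨k, rfl⟩ := Nat.exists_eq_add_of_le hi
      refine ⟨j, 2 * 4 ^ k * (2 * q + 1), le_rfl, ?_⟩
      have : a.head = _ := ha 0
      rw [this, toAdd_mul, PNat.add_coe, h]
      simp
      ring
  obtain ⟨i, q, -, h⟩ := key _ n hn 0 fun i => rfl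
  exact ⟨i, q, h⟩

theorem four_pow_mul_odd_ne (i j p q : ℕ) :
    4 ^ i * (2 * p + 1) ≠ 2 * (4 ^ j * (2 * q + 1)) := by
  induction i generalizing j with
  | zero => omega
  | succ i ih =>
    cases j with
    | zero =>
      rw [pow_succ, mul_right_comm]
      omega
    | succ j =>
      intro h
      refine ih j ?_
      rw [pow_succ, pow_succ, mul_right_comm, mul_right_comm (4 ^ j)] at h
      omega

theorem not_idemCommOn_multiplicative_pnat : ¬ idemCommOn (lambdaS (Multiplicative ℕ+)) := by
  intro h
  obtain ⟨U, hU, hUc⟩ := exists_idempotent_four_pow 1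
  obtain ⟨V, hV, hVc⟩ := exists_idempotent_four_pow 2
  have hc := h _ (Upfamily.ofUltrafilter_mem_lambdaS U) _ (Upfamily.ofUltrafilter_mem_lambdaS V)
    (by rw [← Upfamily.ofUltrafilter_mul, hU]) (by rw [← Upfamily.ofUltrafilter_mul, hV])
  rw [← Upfamily.ofUltrafilter_mul, ← Upfamily.ofUltrafilter_mul] at hc
  have key : ∀ (c : ℕ+) (U V : Ultrafilter (Multiplicative ℕ+)), V * V = V →
    (∀ᶠ n : Multiplicative ℕ+ in U, ∃ i q : ℕ, (n.toAdd : ℕ) = c * (4 ^ i * (2 * q + 1))) →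
    ∀ᶠ n : Multiplicative ℕ+ in ↑(U * V), ∃ i q : ℕ, (n.toAdd : ℕ) = c * (4 ^ i * (2 * q + 1)) := by
    intro c U V hV hU
    rw [Ultrafilter.eventually_mul]
    filter_upwards [hU] with m ⟨i, q, hm⟩
    filter_upwards [eventually_dvd_of_idempotent hV (c * (4 ^ i * 2))] with n ⟨k, hn⟩
    refine ⟨i, q + k, ?_⟩
    rw [toAdd_mul, PNat.add_coe, hm, hn]
    ring
  have h1 := key 1 U V hV hUc
  have h2 := key 2 V U hU hVc
  have h3 : {n : Multiplicative ℕ+ | ∃ i q : ℕ, (n.toAdd : ℕ) = (2 : ℕ+) * (4 ^ i * (2 * q + 1))} ∈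
    (Upfamily.ofUltrafilter (U * V)).1 := hc ▸ h2
  obtain ⟨n, ⟨i, p, hn⟩, j, q, hn'⟩ := (h1.and h3).exists
  refine four_pow_mul_odd_ne i j p q ?_
  rw [PNat.one_coe, one_mul] at hn
  exact hn.symm.trans hn'

end

/-- If the idempotents of the superextension commute, every element has finite order. -/
theorem exists_ppow_eq {X : Type*} [Semigroup X] (hI : idemCommOn (lambdaS X)) (x : X) :
    ∃ i j, i < j ∧ ppow x i = ppow x j := by
  by_contra! h
  refine not_idemCommOn_multiplicative_pnat
    (hI.of_injective (f := fun n : Multiplicative ℕ+ => ppow x n.toAdd.natPred) ?_ ?_)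
  · intro m n hmn
    have : m.toAdd.natPred = n.toAdd.natPred := by
      rcases lt_trichotomy m.toAdd.natPred n.toAdd.natPred with h' | h' | h'
      · exact absurd hmn (h _ _ h')
      · exact h'
      · exact absurd hmn.symm (h _ _ h')
    exact Multiplicative.toAdd.injective (PNat.natPred_injective this)
  · intro m n
    rw [ppow_mul_ppow]
    congr 1
    have := m.toAdd.pos
    have := n.toAdd.pos
    simp only [PNat.natPred, toAdd_mul, PNat.add_coe]
    omega

section GeneralSemigroup

variable {M : Type*} [Semigroup M]

theorem exists_mul_ppow_eq {x w : M} (h : w * (x * x) = x) (k : ℕ) :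
    ∃ v, v * ppow x (k + 1) = x := by
  induction k with
  | zero => exact ⟨w, h⟩
  | succ k ih =>
    obtain ⟨v, hv⟩ := ih
    refine ⟨v * w, ?_⟩
    have e : ppow x (k + 1 + 1) = x * x * ppow x k := by
      change _ = ppow x 1 * ppow x k
      rw [ppow_mul_ppow]
      congr 1
      omega
    have e' : ppow x (k + 1) = x * ppow x k := by
      change _ = ppow x 0 * ppow x k
      rw [ppow_mul_ppow]
      congr 1
      omega
    rw [e, mul_assoc v, ← mul_assoc w, h, ← e', hv]

theorem exists_ppow_mul_eq {x w : M} (h : x * x * w = x) (k : ℕ) :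
    ∃ v, ppow x (k + 1) * v = x := by
  induction k with
  | zero => exact ⟨w, h⟩
  | succ k ih =>
    obtain ⟨v, hv⟩ := ih
    refine ⟨w * v, ?_⟩
    have e : ppow x (k + 1 + 1) = ppow x k * (x * x) := by
      change _ = ppow x k * ppow x 1
      rw [ppow_mul_ppow]
    rw [e, mul_assoc, ← mul_assoc _ w, h, ← mul_assoc]
    exact hv

/-- A regular element of finite order lies in a group if the idempotents commute and form a
chain. -/
theorem exists_ppow_eq_self {x y : M} (hxy : x * y * x = x) {i j : ℕ} (hij : i < j)
    (hp : ppow x i = ppow x j) (hcomm : x * y * (y * x) = y * x * (x * y))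
    (hlin : x * y * (y * x) = x * y ∨ x * y * (y * x) = y * x) : ∃ d, ppow x (d + 1) = x := by
  obtain ⟨d, rfl⟩ := Nat.exists_eq_add_of_lt hij
  have e1 : ppow x (i + 1) * ppow x d = ppow x (i + 1) := by
    rw [ppow_mul_ppow, show i + 1 + d + 1 = i + d + 1 + 1 by ring]
    change ppow x _ * x = ppow x _ * x
    rw [hp]
  have e2 : ppow x d * ppow x (i + 1) = ppow x (i + 1) := by
    rw [ppow_mul_ppow, add_comm d, ← ppow_mul_ppow, e1]
  refine ⟨d, ?_⟩
  change ppow x d * ppow x 0 = x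
  rcases hlin with h | h
  · obtain ⟨v, hv⟩ := exists_mul_ppow_eq (x := x) (w := y) (by
      rw [hcomm] at h
      calc y * (x * x) = y * (x * (x * y * x)) := by rw [hxy]
        _ = y * x * (x * y) * x := by simp only [mul_assoc]
        _ = x := by rw [h, hxy]) i
    rw [ppow_mul_ppow, add_comm d, ← ppow_mul_ppow]
    change x * ppow x d = x
    have : v * ppow x (i + 1) * ppow x d = v * ppow x (i + 1) := by rw [mul_assoc, e1]
    rwa [hv] at this
  · obtain ⟨v, hv⟩ := exists_ppow_mul_eq (x := x) (w := y * y * x) (by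
      calc x * x * (y * y * x) = x * (x * y * (y * x)) := by simp only [mul_assoc]
        _ = x := by rw [h, ← mul_assoc, hxy]) i
    change ppow x d * x = x
    have : ppow x d * (ppow x (i + 1) * v) = ppow x (i + 1) * v := by rw [← mul_assoc, e2]
    rwa [hv] at this

end GeneralSemigroup

/-- The algebraic part of the conditions on the superextension. -/
def SuperextensionCondition (X : Type*) [Mul X] : Prop :=
  idemCommOn (lambdaS X) ∧ (subCliffordOn (lambdaS X) ∨ regularIn (lambdaS X) (N2S X))

namespace Upfamily

/-- The family of sets containing at least two of the three points. -/
def triangle {X : Type*} (a b c : X) : Upfamily X :=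
  ofSelfDual (fun A => a ∈ A ∧ b ∈ A ∨ b ∈ A ∧ c ∈ A ∨ a ∈ A ∧ c ∈ A)
    (fun A B h => by
      have := @h a
      have := @h b
      have := @h c
      tauto)
    (fun A => by
      simp only [mem_compl_iff]
      tauto)

variable {X : Type*}

theorem triangle_mem_lambdaS (a b c : X) : triangle a b c ∈ lambdaS X :=
  ofSelfDual_mem_lambdaS _ _ _

theorem mem_triangle {a b c : X} {A : Set X} :
    A ∈ (triangle a b c).1 ↔ a ∈ A ∧ b ∈ A ∨ b ∈ A ∧ c ∈ A ∨ a ∈ A ∧ c ∈ A := Iff.rfl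

theorem exists_of_regular [Semigroup X] {B b : Upfamily X} (hb : b ∈ N2S X) (h : B * b * B = B)
    {C : Set X} (hC : C ∈ B.1) :
    ∃ S ∈ B.1, ∀ u ∈ S, ∀ u' ∈ S,
      ∃ v, {z | u * v * z ∈ C} ∈ B.1 ∧ {z | u' * v * z ∈ C} ∈ B.1 := by
  rw [← h, mem_mul, mem_mul] at hC
  exact ⟨_, hC, fun u hu u' hu' => hb _ hu _ hu'⟩

end Upfamily

namespace SuperextensionCondition

variable {X : Type*} [Semigroup X]

theorem exists_regular (h : SuperextensionCondition X) {B : Upfamily X} (hB : B ∈ lambdaS X)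
    (hBB : B * B = B * B * B) : ∃ b ∈ N2S X, B * b * B = B := by
  rcases h.2 with h | h
  · have : B = B * B := h B hB 0 1 zero_lt_one hBB
    exact ⟨B, Upfamily.linked_of_mem_lambdaS hB, by rw [← this, ← this]⟩
  · exact h B hB

theorem idem_comm (h : SuperextensionCondition X) {e f : X} (he : e * e = e) (hf : f * f = f) :
    e * f = f * e := by
  apply Upfamily.principal_injective
  rw [← Upfamily.principal_mul, ← Upfamily.principal_mul]
  exact h.1 _ (Upfamily.principal_mem_lambdaS e) _ (Upfamily.principal_mem_lambdaS f)
    (by rw [Upfamily.principal_mul, he]) (by rw [Upfamily.principal_mul, hf])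

theorem regular (h : SuperextensionCondition X) (x : X) : ∃ y, x * y * x = x := by
  rcases h.2 with hS | hR
  · have step : ∀ n m, n < m → ppow x (n + 1) = ppow x (m + 1) → ppow x n = ppow x m := by
      intro n m hnm hp
      apply Upfamily.principal_injective
      have hm := map_ppow (f := Upfamily.principal (X := X))
        (fun a b => (Upfamily.principal_mul a b).symm)
      rw [hm, hm]
      exact hS _ (Upfamily.principal_mem_lambdaS x) n m hnm (by rw [← hm, ← hm, hp])
    obtain ⟨i, j, hij, hp⟩ := exists_ppow_eq h.1 x
    obtain ⟨d, rfl⟩ := Nat.exists_eq_add_of_lt hij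
    have hd : ppow x (d + 1) = x := by
      clear hij
      induction i with
      | zero => simpa [ppow] using hp.symm
      | succ i ih =>
        refine ih (step _ _ (by omega) ?_)
        rw [hp]
        congr 1
        omega
    refine ⟨ppow x (2 * d), ?_⟩
    have := ppow_add_mul hd 0 2
    change ppow x 0 * ppow x (2 * d) * ppow x 0 = ppow x 0
    rw [ppow_mul_ppow, ppow_mul_ppow, ← this]
    congr 1
    ring
  · obtain ⟨b, -, hb⟩ := hR _ (Upfamily.principal_mem_lambdaS x)
    have hx : {x} ∈ (Upfamily.principal x).1 := mem_singleton x
    rw [← hb, Upfamily.mem_mul, Upfamily.mem_mul, Upfamily.mem_principal] at hx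
    obtain ⟨y, hy⟩ := b.nonempty_of_mem hx
    exact ⟨y, hy⟩

theorem idem_linear (h : SuperextensionCondition X) {e f : X} (he : e * e = e) (hf : f * f = f) :
    e * f = e ∨ e * f = f := by
  by_contra! hne
  have hc := h.idem_comm he hf
  obtain ⟨g, hg⟩ : ∃ g, e * f = g := ⟨_, rfl⟩
  have hfe : f * e = g := hc ▸ hg
  have heg : e * g = g := by rw [← hg, ← mul_assoc, he]
  have hgf : g * f = g := by rw [← hg, mul_assoc, hf]
  have hge : g * e = g := by rw [← hfe, mul_assoc, he]
  have hfg : f * g = g := by rw [← hfe, ← mul_assoc, hf]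
  have hgg : g * g = g := by nth_rw 2 [← hg]; rw [← mul_assoc, hge, hgf]
  rw [hg] at hne
  have hBB : Upfamily.triangle e f g * Upfamily.triangle e f g = Upfamily.principal g := by
    refine Upfamily.ext fun C => ?_
    simp only [Upfamily.mem_mul, Upfamily.mem_triangle, Upfamily.mem_principal, mem_ofPred_eq,
      he, hf, hg, hfe, heg, hgf, hge, hfg, hgg]
    tauto
  have hBBB : Upfamily.principal g * Upfamily.triangle e f g = Upfamily.principal g := by
    refine Upfamily.ext fun C => ?_
    simp only [Upfamily.mem_mul, Upfamily.mem_triangle, Upfamily.mem_principal, mem_ofPred_eq,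
      hgf, hge, hgg]
    tauto
  obtain ⟨b, hb, hreg⟩ := h.exists_regular (Upfamily.triangle_mem_lambdaS e f g)
    (by rw [hBB, hBBB])
  obtain ⟨S, hS, hSv⟩ := Upfamily.exists_of_regular hb hreg
    (C := {e, f}) (Or.inl ⟨Or.inl rfl, Or.inr rfl⟩)
  have hgS : g ∉ S := by
    intro hgS
    obtain ⟨v, hv, -⟩ := hSv g hgS g hgS
    obtain ⟨z, hz⟩ := Upfamily.nonempty_of_mem _ hv
    rcases hz with hz | hz
    · exact hne.1 (by rw [← hge, ← hz]; simp only [← mul_assoc, hgg])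
    · exact hne.2 (by rw [← hgf, ← show _ = f from hz]; simp only [← mul_assoc, hgg])
  have heS : e ∈ S ∧ f ∈ S := by
    rw [Upfamily.mem_triangle] at hS
    tauto
  obtain ⟨v, hv, hv'⟩ := hSv e heS.1 f heS.2
  have hv1 : ∀ z, e * v * z ∈ ({e, f} : Set X) → e * v * z = e := by
    rintro z (hz | hz)
    · exact hz
    · refine absurd ?_ hne.2
      rw [← hg, ← show _ = f from hz]
      simp only [← mul_assoc, he]
  have hv2 : ∀ z, f * v * z ∈ ({e, f} : Set X) → f * v * z = f := by
    rintro z (hz | hz)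
    · refine absurd ?_ hne.1
      rw [← hfe, ← hz]
      simp only [← mul_assoc, hf]
    · exact hz
  have hg1 : e * v * g ≠ e := fun h => hne.1 <| by
    have : e * v * g * g = e * v * g := by rw [mul_assoc _ g, hgg]
    rwa [h, heg] at this
  have hg2 : e * v * f ≠ e := fun h => hne.1 <| by
    have : e * v * f * f = e * v * f := by rw [mul_assoc _ f, hf]
    rwa [h, hg] at this
  have hv3 : ∀ z, z ∈ {z | e * v * z ∈ ({e, f} : Set X)} → z ≠ g ∧ z ≠ f := fun z hz =>
    ⟨fun h => hg1 (h ▸ hv1 z hz), fun h => hg2 (h ▸ hv1 z hz)⟩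
  rcases hv with ⟨-, hz⟩ | ⟨-, hz⟩ | ⟨-, hz⟩
  · exact (hv3 _ hz).2 rfl
  · exact (hv3 _ hz).1 rfl
  · exact (hv3 _ hz).1 rfl

theorem exists_ppow_eq_self (h : SuperextensionCondition X) (x : X) :
    ∃ d, ppow x (d + 1) = x := by
  obtain ⟨y, hxy⟩ := h.regular x
  obtain ⟨i, j, hij, hp⟩ := exists_ppow_eq h.1 x
  have h1 : x * y * (x * y) = x * y := by rw [← mul_assoc, hxy]
  have h2 : y * x * (y * x) = y * x := by rw [mul_assoc, ← mul_assoc x, hxy]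
  exact _root_.exists_ppow_eq_self hxy hij hp (h.idem_comm h1 h2) (h.idem_linear h1 h2)

theorem exists_group (h : SuperextensionCondition X) (x : X) :
    ∃ e y, e * e = e ∧ e * x = x ∧ x * e = x ∧ x * y = e ∧ y * x = e := by
  obtain ⟨d, hd⟩ := h.exists_ppow_eq_self x
  obtain ⟨-, e, he, hid, hinv⟩ := isSubgroupIn_range_ppow hd
  obtain ⟨y, -, hy1, hy2⟩ := hinv x ⟨0, rfl⟩
  exact ⟨e, y, (hid e he).1, (hid x ⟨0, rfl⟩).1, (hid x ⟨0, rfl⟩).2, hy1, hy2⟩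

theorem idem_central (h : SuperextensionCondition X) {e : X} (he : e * e = e) (x : X) :
    e * x = x * e := by
  have h1 : e * x * e = e * x := by
    obtain ⟨g, y, hg, h1, h2, h3, h4⟩ := h.exists_group (e * x)
    have hge : g * e = g := by
      rw [← h.idem_comm he hg, ← h3, ← mul_assoc, ← mul_assoc, he]
    rw [← h2, mul_assoc, hge]
  have h2 : e * (x * e) = x * e := by
    obtain ⟨g, y, hg, h1, h2, h3, h4⟩ := h.exists_group (x * e)
    have hge : e * g = g := by
      rw [h.idem_comm he hg, ← h4, mul_assoc, mul_assoc, he]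
    rw [← h1, ← mul_assoc, hge]
  rw [← h1, mul_assoc, h2]

end SuperextensionCondition

/-- The maximal subgroup of a semigroup with identity `e`. -/
def maxSubgroup {X : Type*} [Semigroup X] (e : X) : Set X :=
  {x | e * x = x ∧ x * e = x ∧ ∃ y, x * y = e ∧ y * x = e}

section

variable {X : Type*} [Semigroup X] {e : X}

theorem mul_mem_maxSubgroup {x y : X} (hx : x ∈ maxSubgroup e) (hy : y ∈ maxSubgroup e) :
    x * y ∈ maxSubgroup e := by
  obtain ⟨h1, h2, x', h3, h4⟩ := hx
  obtain ⟨h1', h2', y', h3', h4'⟩ := hy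
  refine ⟨by rw [← mul_assoc, h1], by rw [mul_assoc, h2'], y' * x', ?_, ?_⟩
  · rw [mul_assoc, ← mul_assoc y, h3', ← mul_assoc, h2, h3]
  · rw [mul_assoc, ← mul_assoc x', h4, h1', h4']

theorem exists_inv_mem_maxSubgroup (he : e * e = e) {x : X} (hx : x ∈ maxSubgroup e) :
    ∃ y ∈ maxSubgroup e, y * x = e := by
  obtain ⟨h1, h2, y, h3, h4⟩ := hx
  have h5 : e * y * e * x = e := by rw [mul_assoc, h1, mul_assoc, h4, he]
  have h6 : x * (e * y * e) = e := by rw [← mul_assoc, ← mul_assoc, h2, h3, he]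
  refine ⟨e * y * e, ⟨?_, ?_, x, h5, h6⟩, h5⟩
  · rw [← mul_assoc, ← mul_assoc, he]
  · rw [mul_assoc, he]

theorem self_mem_maxSubgroup (he : e * e = e) : e ∈ maxSubgroup e := ⟨he, he, e, he, he⟩

/-- The group structure of a maximal subgroup. -/
noncomputable abbrev maxSubgroupGroup (he : e * e = e) : Group (maxSubgroup e) :=
  letI : Mul (maxSubgroup e) := ⟨fun x y => ⟨x * y, mul_mem_maxSubgroup x.2 y.2⟩⟩
  letI : One (maxSubgroup e) := ⟨⟨e, self_mem_maxSubgroup he⟩⟩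
  letI : Inv (maxSubgroup e) := ⟨fun x => ⟨(exists_inv_mem_maxSubgroup he x.2).choose,
    (exists_inv_mem_maxSubgroup he x.2).choose_spec.1⟩⟩
  Group.ofLeftAxioms (fun x y z => Subtype.ext (mul_assoc x.1 y.1 z.1))
    (fun x => Subtype.ext x.2.1)
    (fun x => Subtype.ext (exists_inv_mem_maxSubgroup he x.2).choose_spec.2)

end

section

variable {G : Type*} [Group G] {D : Set G} {k : ℕ}

/-- The sets that belong to the maximal linked upfamily on a group used to bound its order. -/
def IsGroupLarge (D : Set G) (k : ℕ) (A : Set G) : Prop :=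
  A = D ∨ (1 ∈ A ∧ k < A.encard ∧ k < Aᶜ.encard) ∨ (Aᶜ.encard ≤ k ∧ Aᶜ ≠ D)

theorem lt_encard_compl {α : Type*} {k : ℕ} (hG : 2 * k < (univ : Set α).encard) {A : Set α}
    (hA : A.encard ≤ k) :
    k < Aᶜ.encard := by
  by_contra! h
  rw [← encard_add_encard_compl A, two_mul] at hG
  exact absurd (add_le_add hA h) (not_le.2 hG)

theorem isGroupLarge_of_le (hG : 2 * k < (univ : Set G).encard) {A : Set G} (hA : A.encard ≤ k) :
    IsGroupLarge D k A ↔ A = D := by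
  have := lt_encard_compl hG hA
  simp only [IsGroupLarge, not_lt.2 hA, not_le.2 this]
  tauto

theorem isGroupLarge_of_compl_le (hG : 2 * k < (univ : Set G).encard) (hD : D.encard = k)
    {A : Set G} (hA : Aᶜ.encard ≤ k) : IsGroupLarge D k A ↔ Aᶜ ≠ D := by
  have := lt_encard_compl hG hA
  rw [compl_compl] at this
  have hAD : A ≠ D := by
    rintro rfl
    exact this.ne' hD
  simp only [IsGroupLarge, hA, not_lt.2 hA, hAD]
  tauto

theorem isGroupLarge_of_lt (hD : D.encard = k) {A : Set G} (hA : k < A.encard)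
    (hA' : k < Aᶜ.encard) : IsGroupLarge D k A ↔ 1 ∈ A := by
  have hAD : A ≠ D := by
    rintro rfl
    exact hA.ne' hD
  simp only [IsGroupLarge, hA, hA', hAD, not_le.2 hA']
  tauto

/-- The maximal linked upfamily on a group consisting of the large sets. -/
def groupUpfamily (hG : 2 * k < (univ : Set G).encard) (hD : D.encard = k) (h1 : 1 ∈ D) :
    Upfamily G :=
  Upfamily.ofSelfDual (IsGroupLarge D k)
    (by
      intro A B hAB hA
      rcases le_or_gt A.encard k with h | h
      · rw [isGroupLarge_of_le hG h] at hA
        subst hA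
        rcases eq_or_ne B A with rfl | hne
        · exact Or.inl rfl
        have hlt : k < B.encard := by
          rw [← hD]
          exact (finite_of_encard_eq_coe hD).encard_lt_encard (hAB.ssubset_of_ne hne.symm)
        rcases le_or_gt Bᶜ.encard k with h' | h'
        · refine Or.inr (Or.inr ⟨h', fun h => ?_⟩)
          exact (h ▸ h1 : (1 : G) ∈ Bᶜ) (hAB h1)
        · exact Or.inr (Or.inl ⟨hAB h1, hlt, h'⟩)
      rcases le_or_gt Bᶜ.encard k with h' | h'
      · rw [isGroupLarge_of_compl_le hG hD h']
        rintro rfl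
        rcases hA with rfl | ⟨hA, -⟩ | ⟨hA, hne⟩
        · exact h.ne' hD
        · exact h1 (hAB hA)
        · exact hne ((finite_of_encard_eq_coe hD).eq_of_subset_of_encard_le
            (compl_subset_compl.2 hAB) (hA.trans hD.ge)).symm
      · have hA' := h'.trans_le (encard_le_encard (compl_subset_compl.2 hAB))
        rw [isGroupLarge_of_lt hD h hA'] at hA
        rw [isGroupLarge_of_lt hD (h.trans_le (encard_le_encard hAB)) h']
        exact hAB hA)
    (by
      intro A
      rcases le_or_gt A.encard k with h | h
      · rw [isGroupLarge_of_le hG h, isGroupLarge_of_compl_le hG hD (by rwa [compl_compl]),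
          compl_compl]
      rcases le_or_gt Aᶜ.encard k with h' | h'
      · rw [isGroupLarge_of_le hG h', isGroupLarge_of_compl_le hG hD h', not_not]
      · rw [isGroupLarge_of_lt hD h h', isGroupLarge_of_lt hD h' (by rwa [compl_compl]),
          mem_compl_iff])

theorem encard_translate (x : G) (C : Set G) : {y | x * y ∈ C}.encard = C.encard :=
  encard_preimage_of_bijective (Group.mulLeft_bijective x) C

theorem groupUpfamily_mul_self (hG : 2 * k < (univ : Set G).encard) (hD : D.encard = k)
    (h1 : 1 ∈ D) (hk : 1 < k) (hstab : ∀ w, (∀ z, w * z ∈ D ↔ z ∈ D) → w = 1) (C : Set G) :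
    C ∈ (groupUpfamily hG hD h1 * groupUpfamily hG hD h1).1 ↔
      Cᶜ.encard ≤ k ∨ k < C.encard ∧ 1 ∈ C := by
  have hsub : ∀ C : Set G, {x | {y | x * y ∈ C} = D}.encard ≤ 1 := by
    intro C
    rw [encard_le_one_iff]
    intro x x' hx hx'
    refine (inv_mul_eq_one.1 (hstab (x⁻¹ * x') fun z => ?_))
    constructor
    · intro h
      rw [← (hx : _ = D)] at h
      rw [← (hx' : _ = D)]
      simpa [← mul_assoc] using h
    · intro h
      rw [← (hx' : _ = D)] at h
      rw [← (hx : _ = D)]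
      simpa [← mul_assoc] using h
  have hne : ∀ C : Set G, {x | {y | x * y ∈ C} = D} ≠ D := by
    intro C h
    have := hsub C
    rw [h, hD] at this
    exact absurd hk (not_lt.2 (by exact_mod_cast this))
  have hk' : ((1 : ℕ) : ℕ∞) ≤ k := by exact_mod_cast hk.le
  rw [Upfamily.mem_mul]
  change IsGroupLarge D k {x | IsGroupLarge D k {y | x * y ∈ C}} ↔ _
  rcases le_or_gt C.encard k with h | h
  · simp only [fun x => isGroupLarge_of_le (D := D) hG ((encard_translate x C).trans_le h)]
    rw [isGroupLarge_of_le hG ((hsub C).trans hk')]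
    simp only [hne C, not_lt.2 h, not_le.2 (lt_encard_compl hG h)]
    tauto
  rcases le_or_gt Cᶜ.encard k with h' | h'
  · simp only [fun x => isGroupLarge_of_compl_le (A := {y | x * y ∈ C}) hG hD
      ((encard_translate x Cᶜ).trans_le h')]
    rw [isGroupLarge_of_compl_le hG hD]
    · simp only [h', true_or, iff_true]
      convert hne Cᶜ
      ext x
      simp [compl_ofPred]
    · refine le_trans ?_ ((hsub Cᶜ).trans hk')
      exact encard_le_encard fun x hx => not_not.1 hx
  · simp only [fun x => isGroupLarge_of_lt (A := {y | x * y ∈ C}) hD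
      (h.trans_eq (encard_translate x C).symm) (h'.trans_eq (encard_translate x Cᶜ).symm)]
    simp only [mem_ofPred_eq, mul_one]
    rw [show {x | x ∈ C} = C from rfl, isGroupLarge_of_lt hD h h']
    simp [h, not_le.2 h']

theorem groupUpfamily_cube (hG : 2 * k < (univ : Set G).encard) (hD : D.encard = k)
    (h1 : 1 ∈ D) (hk : 1 < k) (hstab : ∀ w, (∀ z, w * z ∈ D ↔ z ∈ D) → w = 1) :
    groupUpfamily hG hD h1 * groupUpfamily hG hD h1 =
      groupUpfamily hG hD h1 * groupUpfamily hG hD h1 * groupUpfamily hG hD h1 := by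
  refine Upfamily.ext fun C => ?_
  have hmul := groupUpfamily_mul_self hG hD h1 hk hstab
  rw [mul_assoc, Upfamily.mem_mul _ (_ * _)]
  simp only [hmul]
  have hc : ∀ x, {y | x * y ∈ C}ᶜ.encard = Cᶜ.encard := fun x => encard_translate x Cᶜ
  simp only [hc, encard_translate, mem_ofPred_eq, mul_one]
  rcases le_or_gt Cᶜ.encard k with h' | h'
  · simp only [h', true_or]
    exact iff_of_true trivial (groupUpfamily hG hD h1).univ_mem
  rcases le_or_gt C.encard k with h | h
  · simp only [not_le.2 h', not_lt.2 h, false_and, or_self]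
    exact iff_of_false id (groupUpfamily hG hD h1).empty_notMem
  · simp only [not_le.2 h', h, true_and, false_or]
    exact (isGroupLarge_of_lt hD h h').symm

end

section

variable {G : Type*} [Group G]

theorem exists_trivial_stabilizer (hG : 2 < (univ : Set G).encard) :
    ∃ (D : Set G) (k : ℕ), D.encard = k ∧ 1 < k ∧ 1 ∈ D ∧
      (∀ w, (∀ z, w * z ∈ D ↔ z ∈ D) → w = 1) ∧ (k = 2 ∨ k = 3 ∧ ∀ a : G, a * a = 1) := by
  by_cases h : ∀ a : G, a * a = 1
  · obtain ⟨a, ha⟩ : ∃ a : G, a ≠ 1 := by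
      by_contra! ha
      have : (univ : Set G).encard ≤ 1 :=
        encard_le_one_iff.2 fun x y _ _ => by rw [ha x, ha y]
      exact absurd (hG.trans_le this) (by decide)
    obtain ⟨b, hb⟩ : ∃ b : G, b ∉ ({1, a} : Set G) := by
      by_contra! hb
      have : (univ : Set G).encard ≤ ({1, a} : Set G).encard :=
        encard_le_encard fun x _ => hb x
      rw [encard_pair ha.symm] at this
      exact absurd hG (not_lt.2 this)
    simp only [mem_insert_iff, mem_singleton_iff, not_or] at hb
    refine ⟨{1, a, b}, 3, ?_, by decide, by simp, fun w hw => ?_, Or.inr ⟨rfl, h⟩⟩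
    · rw [encard_insert_of_notMem (by simp [ha.symm, Ne.symm hb.1]), encard_pair (Ne.symm hb.2)]
      norm_num
    have h1 := (hw 1).2 (by simp)
    have h2 := (hw a).2 (by simp)
    have h3 := (hw b).2 (by simp)
    simp only [mem_insert_iff, mem_singleton_iff, mul_one] at h1 h2 h3
    rcases h1 with rfl | rfl | rfl
    · rfl
    · simp only [mul_eq_left, mul_eq_right, ha, hb.1, or_false] at h3
      rw [← h w, mul_right_inj] at h3
      exact absurd h3 hb.2
    · simp only [mul_eq_left, mul_eq_right, ha, hb.1, or_false] at h2
      rw [← h w, mul_right_inj] at h2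
      exact absurd h2.symm hb.2
  · push Not at h
    obtain ⟨a, ha⟩ := h
    have ha1 : a ≠ 1 := by
      rintro rfl
      simp at ha
    refine ⟨{1, a}, 2, encard_pair ha1.symm, by decide, by simp, fun w hw => ?_, Or.inl rfl⟩
    have h1 := (hw 1).2 (by simp)
    have h2 := (hw a).2 (by simp)
    simp only [mem_insert_iff, mem_singleton_iff, mul_one] at h1 h2
    rcases h1 with rfl | rfl
    · rfl
    · simp only [mul_eq_left, ha, ha1, false_or] at h2

theorem mul_mul_eq_of_forall_mem {X : Type*} [Semigroup X] {ι : G → X} (hι : Function.Injective ι)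
    (hmul : ∀ x y, ι (x * y) = ι x * ι y) {D : Set G} (hD : D.Finite) (h1 : 1 ∈ D)
    (hstab : ∀ w, (∀ z, w * z ∈ D ↔ z ∈ D) → w = 1) {g : G} {v : X}
    (h : ∀ d ∈ D, ι g * v * ι d ∈ ι '' D) : ι 1 * v * ι 1 = ι g⁻¹ := by
  obtain ⟨w, -, hw⟩ := h 1 h1
  have hsub : D ⊆ {z | w * z ∈ D} := by
    intro d hd
    obtain ⟨d', hd', e⟩ := h d hd
    have : w * d = d' := hι (by rw [hmul, hw, mul_assoc _ (ι 1), ← hmul, one_mul, e])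
    rwa [mem_ofPred_eq, this]
  have heq := hD.eq_of_subset_of_encard_le hsub (encard_translate w D).le
  have hw1 : w = 1 := hstab w fun z => by
    change z ∈ {z | w * z ∈ D} ↔ _
    rw [← heq]
  rw [hw1] at hw
  calc ι 1 * v * ι 1 = ι g⁻¹ * (ι g * v * ι 1) := by
        rw [← mul_assoc, ← mul_assoc, ← hmul, inv_mul_cancel]
    _ = ι g⁻¹ := by rw [← hw, ← hmul, mul_one]

end

namespace SuperextensionCondition

variable {X : Type*} [Semigroup X] {G : Type*} [Group G] {ι : G → X}

theorem encard_univ_le_two_mul (h : SuperextensionCondition X) (hι : Function.Injective ι)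
    (hmul : ∀ x y, ι (x * y) = ι x * ι y) {D : Set G} {k : ℕ} (hD : D.encard = k) (h1 : 1 ∈ D)
    (hk : 1 < k) (hstab : ∀ w, (∀ z, w * z ∈ D ↔ z ∈ D) → w = 1) :
    (univ : Set G).encard ≤ 2 * k := by
  by_contra! hG
  have hB : Upfamily.map ι (groupUpfamily hG hD h1) ∈ lambdaS X :=
    Upfamily.map_mem_lambdaS ι (Upfamily.ofSelfDual_mem_lambdaS _ _ _)
  obtain ⟨b, hb, hreg⟩ := h.exists_regular hB (by
    rw [← Upfamily.map_mul ι hmul, ← Upfamily.map_mul ι hmul,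
      ← groupUpfamily_cube hG hD h1 hk hstab])
  have hlt : ∀ A : Set G, A ∈ (groupUpfamily hG hD h1).1 → 1 < A.encard := by
    intro A hA
    rcases le_or_gt A.encard k with hle | hlt
    · rw [(isGroupLarge_of_le hG hle).1 hA, hD]
      exact_mod_cast hk
    · exact lt_trans (by exact_mod_cast hk) hlt
  obtain ⟨S, hS, hSv⟩ := Upfamily.exists_of_regular hb hreg (C := ι '' D) (by
    rw [Upfamily.mem_map, preimage_image_eq _ hι]
    exact Or.inl rfl)
  obtain ⟨g, g', hg, hg', hne⟩ := one_lt_encard_iff.1 (hlt _ hS)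
  obtain ⟨v, hv, hv'⟩ := hSv _ hg _ hg'
  have key : ∀ g, {z | ι g * v * z ∈ ι '' D} ∈ (Upfamily.map ι (groupUpfamily hG hD h1)).1 →
      ι 1 * v * ι 1 = ι g⁻¹ := by
    intro g hv
    refine mul_mul_eq_of_forall_mem hι hmul (finite_of_encard_eq_coe hD) h1 hstab ?_
    obtain ⟨z, d, hd, hz⟩ := Upfamily.nonempty_of_mem _ (Upfamily.mem_map.1 hv)
    have hw : ∀ x, ι g * v * ι x = ι (d * z⁻¹ * x) := fun x => by
      rw [mul_assoc d, hmul, hz, mul_assoc _ (ι z), ← hmul, mul_inv_cancel_left]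
    have hK : ι ⁻¹' {z | ι g * v * z ∈ ι '' D} = {x | d * z⁻¹ * x ∈ D} := by
      ext x
      rw [mem_preimage, mem_ofPred_eq, hw, hι.mem_set_image, mem_ofPred_eq]
    rw [Upfamily.mem_map, hK] at hv
    have hDK := (isGroupLarge_of_le hG ((encard_translate _ _).trans hD).le).1 hv
    intro x hx
    rw [hw, hι.mem_set_image]
    rw [← hDK] at hx
    exact hx
  exact hne (inv_injective (hι ((key g hv).symm.trans (key g' hv'))))

theorem encard_univ_le_four (h : SuperextensionCondition X) (hι : Function.Injective ι)
    (hmul : ∀ x y, ι (x * y) = ι x * ι y) : (univ : Set G).encard ≤ 4 := by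
  rcases le_or_gt (univ : Set G).encard 2 with h2 | h2
  · exact h2.trans (by decide)
  obtain ⟨D, k, hD, hk, h1, hstab, rfl | ⟨rfl, hexp⟩⟩ := exists_trivial_stabilizer h2
  · exact (h.encard_univ_le_two_mul hι hmul hD h1 hk hstab).trans (by decide)
  · have h6 := h.encard_univ_le_two_mul hι hmul hD h1 hk hstab
    have hfin : (univ : Set G).Finite := finite_of_encard_le_coe (k := 6) (h6.trans (by decide))
    have : Finite G := finite_univ_iff.1 hfin
    have : Fact (Nat.Prime 2) := ⟨Nat.prime_two⟩
    obtain ⟨n, hn⟩ := IsPGroup.iff_card.1 (show IsPGroup 2 G from fun g => ⟨1, by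
      rw [pow_one, pow_two, hexp]⟩)
    rw [← hfin.cast_ncard_eq, ncard_univ, hn] at h6 ⊢
    have h6' : 2 ^ n ≤ 6 := by exact_mod_cast h6
    have h4 : 2 ^ n ≤ 4 := by
      have : n < 3 := by
        by_contra! h3
        have := Nat.pow_le_pow_right two_pos h3
        omega
      interval_cases n <;> decide
    exact_mod_cast h4

end SuperextensionCondition

theorem mul_comm_of_encard_le_four {G : Type*} [Group G] (hG : (univ : Set G).encard ≤ 4)
    (a b : G) : a * b = b * a := by
  by_contra hab
  have ha : a ≠ 1 := by
    rintro rfl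
    simp at hab
  have hb : b ≠ 1 := by
    rintro rfl
    simp at hab
  have hne : a ≠ b := by
    rintro rfl
    exact hab rfl
  have h1 : a * b ≠ 1 := fun h => hab (by rw [h, mul_eq_one_comm.1 h])
  have h2 : b * a ≠ 1 := fun h => hab (by rw [h, mul_eq_one_comm.1 h])
  have h5 : ({1, a, b, a * b, b * a} : Set G).encard = 5 := by
    rw [encard_insert_of_notMem, encard_insert_of_notMem, encard_insert_of_notMem,
      encard_pair hab]
    · norm_num
    · simp [ha]
    · simp [hb, hne]
    · simp [ha.symm, hb.symm, h1.symm, h2.symm]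
  exact absurd ((h5.ge.trans (encard_le_encard (subset_univ _))).trans hG) (by decide)

theorem Upfamily.map_hyperfilter_mul_left {X : Type*} [Mul X] {p q : ℕ → X}
    (h : ∀ m, ∀ᶠ n in Filter.atTop, p m * q n = p m) :
    Upfamily.map p (ofUltrafilter (Filter.hyperfilter ℕ)) *
      Upfamily.map q (ofUltrafilter (Filter.hyperfilter ℕ)) =
      Upfamily.map p (ofUltrafilter (Filter.hyperfilter ℕ)) := by
  refine Upfamily.ext fun C => ?_
  rw [Upfamily.mem_mul, Upfamily.mem_map, Upfamily.mem_map]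
  have : p ⁻¹' {x | {y | x * y ∈ C} ∈
      (Upfamily.map q (ofUltrafilter (Filter.hyperfilter ℕ))).1} = p ⁻¹' C := by
    ext m
    have hm : ∀ᶠ n in (Filter.hyperfilter ℕ : Filter ℕ), p m * q n = p m :=
      Nat.hyperfilter_le_atTop (h m)
    change (∀ᶠ n in (Filter.hyperfilter ℕ : Filter ℕ), p m * q n ∈ C) ↔ p m ∈ C
    rw [Filter.eventually_congr (hm.mono fun n hn => by rw [hn]), Filter.eventually_const]
  rw [this]

theorem Upfamily.map_hyperfilter_mul_right {X : Type*} [Mul X] {p q : ℕ → X}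
    (h : ∀ m, ∀ᶠ n in Filter.atTop, p m * q n = q n) :
    Upfamily.map p (ofUltrafilter (Filter.hyperfilter ℕ)) *
      Upfamily.map q (ofUltrafilter (Filter.hyperfilter ℕ)) =
      Upfamily.map q (ofUltrafilter (Filter.hyperfilter ℕ)) := by
  refine Upfamily.ext fun C => ?_
  rw [Upfamily.mem_mul, Upfamily.mem_map, Upfamily.mem_map]
  change (∀ᶠ m in (Filter.hyperfilter ℕ : Filter ℕ),
    ∀ᶠ n in (Filter.hyperfilter ℕ : Filter ℕ), p m * q n ∈ C) ↔
      ∀ᶠ n in (Filter.hyperfilter ℕ : Filter ℕ), q n ∈ C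
  have : ∀ m, (∀ᶠ n in (Filter.hyperfilter ℕ : Filter ℕ), p m * q n ∈ C) ↔
      ∀ᶠ n in (Filter.hyperfilter ℕ : Filter ℕ), q n ∈ C := fun m => by
    have hm : ∀ᶠ n in (Filter.hyperfilter ℕ : Filter ℕ), p m * q n = q n :=
      Nat.hyperfilter_le_atTop (h m)
    rw [Filter.eventually_congr (hm.mono fun n hn => by rw [hn])]
  simp only [this, Filter.eventually_const]

theorem Upfamily.map_hyperfilter_ne {X : Type*} {p q : ℕ → X} (h : ∀ m n, p m ≠ q n) :
    Upfamily.map p (ofUltrafilter (Filter.hyperfilter ℕ)) ≠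
      Upfamily.map q (ofUltrafilter (Filter.hyperfilter ℕ)) := by
  intro he
  have h1 : range p ∈ (Upfamily.map p (ofUltrafilter (Filter.hyperfilter ℕ))).1 := by
    rw [Upfamily.mem_map, preimage_range]
    exact Upfamily.univ_mem _
  rw [he, Upfamily.mem_map] at h1
  obtain ⟨n, m, hn⟩ := Upfamily.nonempty_of_mem _ h1
  exact h m n hn

namespace SuperextensionCondition

variable {X : Type*} [Semigroup X]

theorem encard_maxSubgroup_le_four (h : SuperextensionCondition X) {e : X} (he : e * e = e) :
    (maxSubgroup e).encard ≤ 4 := by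
  let := maxSubgroupGroup he
  exact (encard_univ (maxSubgroup e)).symm.le.trans
    (h.encard_univ_le_four (ι := Subtype.val) Subtype.val_injective fun _ _ => rfl)

theorem exists_mem_maxSubgroup (h : SuperextensionCondition X) (x : X) :
    ∃ e, e * e = e ∧ x ∈ maxSubgroup e := by
  obtain ⟨e, y, he, h1, h2, h3, h4⟩ := h.exists_group x
  exact ⟨e, he, h1, h2, y, h3, h4⟩

theorem mul_mem_maxSubgroup_of_idem (h : SuperextensionCondition X) {e f x : X} (he : e * e = e)
    (hef : e * f = e) (hx : x ∈ maxSubgroup f) : e * x ∈ maxSubgroup e := by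
  obtain ⟨h1, h2, y, h3, h4⟩ := hx
  refine ⟨by rw [← mul_assoc, he], by rw [mul_assoc, ← h.idem_central he, ← mul_assoc, he],
    e * y, ?_, ?_⟩
  · rw [mul_assoc, ← mul_assoc x, ← h.idem_central he x, mul_assoc, h3, hef, he]
  · rw [mul_assoc, ← mul_assoc y, ← h.idem_central he y, mul_assoc, h4, hef, he]

theorem mul_comm (h : SuperextensionCondition X) (x y : X) : x * y = y * x := by
  have key : ∀ e f x y : X, e * e = e → f * f = f → e * f = e → x ∈ maxSubgroup e →
      y ∈ maxSubgroup f → x * y = y * x := by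
    intro e f x y he hf hef hx hy
    have hcomm : x * (e * y) = e * y * x := by
      let := maxSubgroupGroup he
      exact congrArg Subtype.val (mul_comm_of_encard_le_four
        ((encard_univ (maxSubgroup e)).le.trans (h.encard_maxSubgroup_le_four he))
        (⟨x, hx⟩ : maxSubgroup e) ⟨e * y, h.mul_mem_maxSubgroup_of_idem he hef hy⟩)
    rwa [← mul_assoc, hx.2.1, h.idem_central he, mul_assoc, hx.1] at hcomm
  obtain ⟨e, he, hx⟩ := h.exists_mem_maxSubgroup x
  obtain ⟨f, hf, hy⟩ := h.exists_mem_maxSubgroup y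
  rcases h.idem_linear he hf with hef | hef
  · exact key e f x y he hf hef hx hy
  · exact (key f e y x hf he (by rw [h.idem_central hf, hef]) hy hx).symm

theorem finite_idempotents (h : SuperextensionCondition X) : {e : X | e * e = e}.Finite := by
  by_contra hinf
  have hemb := Set.Infinite.natEmbedding _ hinf
  let r : X → X → Prop := fun x y => x * y = x
  have : IsTrans X r := ⟨fun x y z hxy hyz => by
    change x * z = x
    rw [← show x * y = x from hxy, mul_assoc, show y * z = y from hyz]⟩
  obtain ⟨g, hg⟩ := exists_increasing_or_nonincreasing_subseq r fun n => (hemb n).1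
  obtain ⟨a, ha⟩ : ∃ a : ℕ → X, ∀ n, a n = hemb (g n) := ⟨_, fun _ => rfl⟩
  have hinj : ∀ m n, a m = a n → m = n := fun m n hmn => by
    rw [ha, ha] at hmn
    exact g.injective (hemb.injective (Subtype.ext hmn))
  have hidem : ∀ n, a n * a n = a n := fun n => by
    rw [ha]
    exact (hemb (g n)).2
  have hc : ∀ m n, a m * a n = a n * a m := fun m n => h.idem_comm (hidem m) (hidem n)
  have hle : ∀ m : ℕ, ∀ᶠ n in Filter.atTop, m < n := fun m => Filter.eventually_gt_atTop m
  have hodd : ∀ m n, a (2 * m) ≠ a (2 * n + 1) := fun m n hmn => by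
    have := hinj _ _ hmn
    omega
  refine Upfamily.map_hyperfilter_ne hodd ?_
  have hmem : ∀ p : ℕ → X, Upfamily.map p (Upfamily.ofUltrafilter (Filter.hyperfilter ℕ)) ∈
    lambdaS X := fun p => Upfamily.map_mem_lambdaS _ (Upfamily.ofUltrafilter_mem_lambdaS _)
  have hcomm := h.1 _ (hmem fun n => a (2 * n)) _ (hmem fun n => a (2 * n + 1))
  rcases hg with hg | hg
  · have hm : ∀ m n, m < n → a m * a n = a m := fun m n hmn => by
      rw [ha, ha]
      exact hg m n hmn
    rw [Upfamily.map_hyperfilter_mul_left, Upfamily.map_hyperfilter_mul_left,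
      Upfamily.map_hyperfilter_mul_left, Upfamily.map_hyperfilter_mul_left] at hcomm
    · exact hcomm rfl rfl
    all_goals exact fun m => (hle m).mono fun n hn => hm _ _ (by omega)
  · have hm : ∀ m n, m < n → a m * a n = a n := fun m n hmn => by
      refine (h.idem_linear (hidem m) (hidem n)).resolve_left ?_
      rw [ha, ha]
      exact hg m n hmn
    rw [Upfamily.map_hyperfilter_mul_right, Upfamily.map_hyperfilter_mul_right,
      Upfamily.map_hyperfilter_mul_right, Upfamily.map_hyperfilter_mul_right] at hcomm
    · exact (hcomm rfl rfl).symm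
    all_goals exact fun m => (hle m).mono fun n hn => hm _ _ (by omega)

theorem finite (h : SuperextensionCondition X) : Finite X := by
  rw [← finite_univ_iff]
  refine (h.finite_idempotents.biUnion fun e he => finite_of_encard_le_coe
    (h.encard_maxSubgroup_le_four he)).subset fun x _ => ?_
  obtain ⟨e, he, hx⟩ := h.exists_mem_maxSubgroup x
  exact mem_biUnion he hx

theorem exists_regular_of_finite [Finite X] (h : SuperextensionCondition X) {B : Upfamily X}
    (hB : B ∈ lambdaS X) : ∃ b ∈ N2S X, B * b * B = B := by
  rcases h.2 with hS | hR
  · have : Finite (Upfamily X) := Subtype.finite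
    have hpow : ∀ n, ppow B n ∈ lambdaS X := fun n => by
      induction n with
      | zero => exact hB
      | succ n ih => exact Upfamily.lambdaS_mul ih hB
    obtain ⟨i, j, hij, hp⟩ : ∃ i j, i < j ∧ ppow B i = ppow B j := by
      obtain ⟨i, j, hne, hp⟩ := Finite.exists_ne_map_eq_of_infinite (ppow B)
      rcases hne.lt_or_gt with h | h
      · exact ⟨i, j, h, hp⟩
      · exact ⟨j, i, h, hp.symm⟩
    obtain ⟨d, rfl⟩ := Nat.exists_eq_add_of_lt hij
    have hd : ppow B (d + 1) = B := by
      clear hij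
      induction i with
      | zero => simpa [ppow] using hp.symm
      | succ i ih =>
        refine ih (hS B hB _ _ (by omega) ?_)
        rw [hp]
        congr 1
        omega
    refine ⟨ppow B (2 * d), Upfamily.linked_of_mem_lambdaS (hpow _), ?_⟩
    have := ppow_add_mul hd 0 2
    change ppow B 0 * ppow B (2 * d) * ppow B 0 = ppow B 0
    rw [ppow_mul_ppow, ppow_mul_ppow, ← this]
    congr 1
    ring
  · exact hR B hB

end SuperextensionCondition

namespace Upfamily

/-- The maximal linked upfamily of the sets that contain `D`, or contain `e` and meet `D`. -/
def star {X : Type*} (e : X) (D : Set X) (hD : D.Nonempty) : Upfamily X :=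
  ofSelfDual (fun A => (e ∈ A ∧ (A ∩ D).Nonempty) ∨ D ⊆ A)
    (fun A B hAB h => h.imp
      (fun h => ⟨hAB h.1, h.2.mono (inter_subset_inter_left _ hAB)⟩) fun h => h.trans hAB)
    (fun A => by
      obtain ⟨d, hd⟩ := hD
      simp only [mem_compl_iff, not_or, not_and, not_nonempty_iff_eq_empty, not_subset]
      constructor
      · rintro (⟨he, d', hd', hdD⟩ | h)
        · exact ⟨fun h => absurd h he, d', hdD, hd'⟩
        · exact ⟨fun _ => eq_empty_of_forall_notMem fun x hx => h hx.2 hx.1, d, hd, h hd⟩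
      · rintro ⟨h, d', hd', hdA⟩
        by_cases he : e ∈ A
        · exact Or.inr fun x hx hxA => (h he ▸ ⟨hxA, hx⟩ : x ∈ (∅ : Set X))
        · exact Or.inl ⟨he, d', hdA, hd'⟩)

theorem star_mem_lambdaS {X : Type*} (e : X) (D : Set X) (hD : D.Nonempty) :
    star e D hD ∈ lambdaS X :=
  ofSelfDual_mem_lambdaS _ _ _

theorem subset_of_mem_star {X : Type*} {e : X} {D A : Set X} {hD : D.Nonempty}
    (h : A ∈ (star e D hD).1) (he : e ∉ A) : D ⊆ A :=
  h.resolve_left fun h => he h.1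

end Upfamily

theorem mul_right_inj_of_mem_maxSubgroup {X : Type*} [Semigroup X] {e w a b : X}
    (hw : w ∈ maxSubgroup e) (ha : e * a = a) (hb : e * b = b) (h : w * a = w * b) : a = b := by
  obtain ⟨-, -, y, -, hy⟩ := hw
  rw [← ha, ← hb, ← hy, mul_assoc, mul_assoc, h]

theorem eq_of_mul_mem_maxSubgroup {X : Type*} [Semigroup X] {e f x : X} (hfe : e * f = e)
    (hx : x ∈ maxSubgroup f) (hex : e * x = x) : e = f := by
  obtain ⟨-, -, y, hy, -⟩ := hx
  rw [← hfe, ← hy, ← mul_assoc, hex]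

namespace SuperextensionCondition

variable {X : Type*} [Semigroup X]

theorem encard_maxSubgroup_le_two_of_lt (h : SuperextensionCondition X) {e f : X}
    (he : e * e = e) (hf : f * f = f) (hef : e * f = e) (hne : e ≠ f) :
    (maxSubgroup f).encard ≤ 2 := by
  by_contra! hlt
  have := h.finite
  let := maxSubgroupGroup hf
  rw [← show _ = (maxSubgroup f).encard from encard_univ (maxSubgroup f)] at hlt
  obtain ⟨D, k, hD, hk, h1, hstab, -⟩ := exists_trivial_stabilizer hlt
  have hne' : (Subtype.val '' D).Nonempty := ⟨_, mem_image_of_mem _ h1⟩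
  obtain ⟨b, hb, hreg⟩ := h.exists_regular_of_finite (Upfamily.star_mem_lambdaS e _ hne')
  obtain ⟨S, hS, hSv⟩ := Upfamily.exists_of_regular hb hreg (C := Subtype.val '' D)
    (Or.inr Subset.rfl)
  have hsub : ∀ x ∈ Subtype.val '' D, x ∈ maxSubgroup f := by
    rintro _ ⟨x, -, rfl⟩
    exact x.2
  have heS : e ∉ S := fun heS => by
    obtain ⟨v, hv, -⟩ := hSv e heS e heS
    obtain ⟨z, hz⟩ := Upfamily.nonempty_of_mem _ hv
    exact hne (eq_of_mul_mem_maxSubgroup hef (hsub _ hz) (by simp only [← mul_assoc, he]))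
  have hDS := Upfamily.subset_of_mem_star hS heS
  obtain ⟨g, g', hg, hg', hgg⟩ := one_lt_encard_iff.1
    (show 1 < D.encard by rw [hD]; exact_mod_cast hk)
  obtain ⟨v, hv, hv'⟩ := hSv g (hDS ⟨g, hg, rfl⟩) g' (hDS ⟨g', hg', rfl⟩)
  have key : ∀ g : maxSubgroup f,
      {z | g.1 * v * z ∈ Subtype.val '' D} ∈ (Upfamily.star e _ hne').1 →
      (1 : maxSubgroup f).1 * v * (1 : maxSubgroup f).1 = (g⁻¹).1 := by
    intro g hv
    refine mul_mul_eq_of_forall_mem Subtype.val_injective (fun _ _ => rfl)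
      (finite_of_encard_eq_coe hD) h1 hstab fun d hd => ?_
    refine Upfamily.subset_of_mem_star hv (fun hz => hne ?_) (mem_image_of_mem _ hd)
    exact eq_of_mul_mem_maxSubgroup hef (hsub _ hz)
      (by rw [h.idem_central he, mul_assoc, he])
  exact hgg (inv_injective (Subtype.val_injective ((key g hv).symm.trans (key g' hv'))))

theorem encard_maxSubgroup_le_two_of_gt (h : SuperextensionCondition X) {e f : X}
    (he : e * e = e) (hef : e * f = e) (hne : e ≠ f) :
    (maxSubgroup e).encard ≤ 2 := by
  by_contra! hlt
  have := h.finite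
  have hmin : ∀ x, e * x ∈ maxSubgroup e := by
    intro x
    obtain ⟨g, hg, hx⟩ := h.exists_mem_maxSubgroup x
    refine h.mul_mem_maxSubgroup_of_idem he ?_ hx
    by_contra hge
    refine absurd (h.encard_maxSubgroup_le_two_of_lt hg he ?_ ?_) (not_le.2 hlt)
    · rw [h.idem_comm hg he]
      exact (h.idem_linear he hg).resolve_left hge
    · rintro rfl
      exact hge hg
  obtain ⟨a, ha, hae⟩ : ∃ a ∈ maxSubgroup e, a ≠ e := by
    by_contra! hall
    have := (encard_le_encard (t := {e}) fun a ha => hall a ha).trans_lt (by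
      rw [encard_singleton]
      exact (by decide : (1 : ℕ∞) < 2))
    exact absurd hlt this.le.not_gt
  obtain ⟨b, hb, hbe⟩ : ∃ b ∈ maxSubgroup e, b ∉ ({e, a} : Set X) := by
    by_contra! hall
    have := (encard_le_encard (t := {e, a}) fun a ha => hall a ha).trans (encard_pair hae.symm).le
    exact absurd hlt this.not_gt
  simp only [mem_insert_iff, mem_singleton_iff, not_or] at hbe
  have hfe : f ∉ maxSubgroup e := fun hfe => hne (by rw [← hef, hfe.1])
  obtain ⟨b', hb', hreg⟩ := h.exists_regular_of_finite (Upfamily.triangle_mem_lambdaS f a b)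
  obtain ⟨S, hS, hSv⟩ := Upfamily.exists_of_regular hb' hreg (C := {a, f})
    (Or.inl ⟨Or.inr rfl, Or.inl rfl⟩)
  obtain ⟨u, huS, hu⟩ : ∃ u ∈ S, u ∈ maxSubgroup e := by
    rcases hS with ⟨-, hS⟩ | ⟨hS, -⟩ | ⟨-, hS⟩
    · exact ⟨a, hS, ha⟩
    · exact ⟨a, hS, ha⟩
    · exact ⟨b, hS, hb⟩
  obtain ⟨v, hv, -⟩ := hSv u huS u huS
  have hw : u * v ∈ maxSubgroup e := by
    rw [← hu.1, mul_assoc]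
    exact hmin _
  have hz : ∀ z ∈ {z | u * v * z ∈ ({a, f} : Set X)}, u * v * (e * z) = a := by
    rintro z (hz | hz)
    · rw [← mul_assoc, hw.2.1]
      exact hz
    · refine absurd ?_ hfe
      rw [← show _ = f from hz, ← hw.1, mul_assoc]
      exact hmin _
  have key : ∀ z z', z ∈ {z | u * v * z ∈ ({a, f} : Set X)} →
      z' ∈ {z | u * v * z ∈ ({a, f} : Set X)} → e * z = e * z' := fun z z' h1 h2 =>
    mul_right_inj_of_mem_maxSubgroup hw (by rw [← mul_assoc, he]) (by rw [← mul_assoc, he])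
      ((hz z h1).trans (hz z' h2).symm)
  rcases hv with ⟨h1, h2⟩ | ⟨h1, h2⟩ | ⟨h1, h2⟩
  · have := key _ _ h1 h2
    rw [hef, ha.1] at this
    exact hae this.symm
  · have := key _ _ h1 h2
    rw [hb.1, ha.1] at this
    exact hbe.2 this.symm
  · have := key _ _ h1 h2
    rw [hef, hb.1] at this
    exact hbe.1 this.symm

theorem eq_of_mem_maxSubgroup_of_between (h : SuperextensionCondition X) {e f g s : X}
    (he : e * e = e) (hf : f * f = f) (hg : g * g = g) (hef : e * f = e) (hfg : f * g = f)
    (hnef : e ≠ f) (hnfg : f ≠ g) (hs : s ∈ maxSubgroup f) : s = f := by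
  by_contra hsf
  have := h.finite
  have hes : e ≠ s := by
    rintro rfl
    exact hnef (eq_of_mul_mem_maxSubgroup hef hs he)
  have hgf : g * f = f := by rw [← h.idem_comm hf hg, hfg]
  have hsg : s * g = s := by rw [← hs.2.1, mul_assoc, hfg]
  have hgs : g * s = s := by rw [← hs.1, ← mul_assoc, hgf]
  have heg : e * g = e := by rw [← hef, mul_assoc, hfg]
  have hneg : e ≠ g := by
    rintro rfl
    exact hnef (hef.symm.trans hgf)
  obtain ⟨b, hb, hreg⟩ := h.exists_regular_of_finite (Upfamily.triangle_mem_lambdaS e s g)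
  obtain ⟨S, hS, hSv⟩ := Upfamily.exists_of_regular hb hreg (C := {s, g})
    (Or.inr (Or.inl ⟨Or.inl rfl, Or.inr rfl⟩))
  have hbot : ∀ x, e * x = x → x ∉ ({s, g} : Set X) := by
    rintro x hx (rfl | rfl)
    · exact hnef (eq_of_mul_mem_maxSubgroup hef hs hx)
    · exact hneg (heg.symm.trans hx)
  have heS : e ∉ S := fun heS => by
    obtain ⟨v, hv, -⟩ := hSv e heS e heS
    obtain ⟨z, hz⟩ := Upfamily.nonempty_of_mem _ hv
    exact hbot _ (by simp only [← mul_assoc, he]) hz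
  have hsS : s ∈ S := by
    rcases hS with hS | hS | hS
    · exact hS.2
    · exact hS.1
    · exact absurd hS.1 heS
  obtain ⟨v, hv, -⟩ := hSv s hsS s hsS
  have hz : ∀ z ∈ {z | s * v * z ∈ ({s, g} : Set X)}, s * v * z = s := by
    rintro z (hz | hz)
    · exact hz
    · refine absurd ?_ hnfg
      rw [← hfg, ← show _ = g from hz]
      simp only [← mul_assoc, hs.1]
  have heK : e ∉ {z | s * v * z ∈ ({s, g} : Set X)} := fun hK =>
    hbot _ (by rw [h.idem_central he, mul_assoc, he]) hK
  have hsgK : s ∈ {z | s * v * z ∈ ({s, g} : Set X)} ∧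
      g ∈ {z | s * v * z ∈ ({s, g} : Set X)} := by
    rcases hv with hv | hv | hv
    · exact absurd hv.1 heK
    · exact hv
    · exact absurd hv.1 heK
  have h1 := hz _ hsgK.1
  have h2 := hz _ hsgK.2
  have hss : s * s = s := by
    nth_rw 1 [← h2]
    rw [mul_assoc, hgs, h1]
  exact hsf (mul_right_inj_of_mem_maxSubgroup hs hs.1 hf (by rw [hss, hs.2.1]))

theorem eq_of_fixed (h : SuperextensionCondition X) {f s p q : X} (hf : f * f = f)
    (hfs : f * s = s) (hss : s * s = f) (hsf : s ≠ f) (hfp : f * p = p) (hsp : s * p = p)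
    (hfq : f * q = q) (hsq : s * q = q) : p = q := by
  by_contra hne
  have hc := h.mul_comm
  have key : ∀ p q : X, f * p = p → s * p = p → f * q = q → s * q = q →
      Upfamily.triangle p f s * Upfamily.triangle q f s = Upfamily.triangle q f s := by
    intro p q hfp hsp hfq hsq
    refine Upfamily.ext fun C => ?_
    simp only [Upfamily.mem_mul, Upfamily.mem_triangle, mem_ofPred_eq, hf, hfs, hss, hfq, hsq,
      hc s f, hc p f, hc p s, hfp, hsp]
    by_cases h1 : q ∈ C <;> by_cases h2 : f ∈ C <;> by_cases h3 : s ∈ C <;> simp [h1, h2, h3]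
  have h1 := h.1 _ (Upfamily.triangle_mem_lambdaS p f s) _ (Upfamily.triangle_mem_lambdaS q f s)
    (key p p hfp hsp hfp hsp) (key q q hfq hsq hfq hsq)
  rw [key p q hfp hsp hfq hsq, key q p hfq hsq hfp hsp] at h1
  have h2 : {p, f} ∈ (Upfamily.triangle p f s).1 := Or.inl ⟨Or.inl rfl, Or.inr rfl⟩
  rw [← h1, Upfamily.mem_triangle] at h2
  have h3 : q ∉ ({p, f} : Set X) := by
    rintro (rfl | rfl)
    · exact hne rfl
    · exact hsf (by rw [← hfs, hc, hsq])
  have h4 : s ∉ ({p, f} : Set X) := by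
    rintro (rfl | hs)
    · exact hsf (by rw [← hss, hsp])
    · exact hsf hs
  tauto

end SuperextensionCondition

theorem exists_mulEquiv_linear {X : Type*} [Semigroup X] [Finite X]
    (hc : ∀ x y : X, x * y = y * x) (hl : ∀ x y : X, x * y = x ∨ x * y = y) :
    ∃ n, Nonempty (X ≃* L n) := by
  classical
  let : LinearOrder X :=
    { le := fun x y => x * y = x
      le_refl := fun x => (hl x x).elim id id
      le_trans := fun x y z (hxy : x * y = x) (hyz : y * z = y) => by
        rw [← hxy, mul_assoc, hyz]
      le_antisymm := fun x y (hxy : x * y = x) (hyx : y * x = y) => by rw [← hxy, hc, hyx]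
      le_total := fun x y => (hl x y).imp id fun h => by rwa [hc]
      toDecidableLE := Classical.decRel _ }
  have := Fintype.ofFinite X
  have key : ∀ x y : X, x ≤ y → x * y = x := fun _ _ h => h
  have hmin : ∀ x y : X, x * y = min x y := fun x y => by
    rcases le_total x y with h | h
    · rw [min_eq_left h, key x y h]
    · rw [min_eq_right h, hc, key y x h]
  have φ := (monoEquivOfFin X rfl).symm
  refine ⟨_, ⟨⟨φ.toEquiv, fun x y => ?_⟩⟩⟩
  rw [hmin]
  exact φ.monotone.map_min

/-- The map from the two-element group to a pair. -/
def ofCyclicTwo {X : Type*} (a b : X) (c : Cgrp 2) : X := if c = 1 then a else b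

section

variable {X : Type*} {a b : X}

theorem cyclic_two_cases : ∀ c : Cgrp 2, c = 1 ∨ c = Multiplicative.ofAdd 1 := by decide

theorem ofCyclicTwo_one : ofCyclicTwo a b 1 = a := if_pos rfl

theorem ofCyclicTwo_ofAdd_one : ofCyclicTwo a b (Multiplicative.ofAdd 1) = b :=
  if_neg (by decide)

theorem ofCyclicTwo_injective (hab : a ≠ b) : Function.Injective (ofCyclicTwo a b) := by
  intro c d h
  rcases cyclic_two_cases c with rfl | rfl <;> rcases cyclic_two_cases d with rfl | rfl <;>
    simp_all [ofCyclicTwo_one, ofCyclicTwo_ofAdd_one, eq_comm]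

theorem ofCyclicTwo_mem (c : Cgrp 2) : ofCyclicTwo a b c = a ∨ ofCyclicTwo a b c = b := by
  rcases cyclic_two_cases c with rfl | rfl
  · exact Or.inl ofCyclicTwo_one
  · exact Or.inr ofCyclicTwo_ofAdd_one

theorem ofCyclicTwo_mul [Mul X] (haa : a * a = a) (hab : a * b = b) (hba : b * a = b)
    (hbb : b * b = a) (c d : Cgrp 2) :
    ofCyclicTwo a b (c * d) = ofCyclicTwo a b c * ofCyclicTwo a b d := by
  have h1 : (Multiplicative.ofAdd 1 * Multiplicative.ofAdd 1 : Cgrp 2) = 1 := by decide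
  rcases cyclic_two_cases c with rfl | rfl <;> rcases cyclic_two_cases d with rfl | rfl <;>
    simp only [one_mul, mul_one, ofCyclicTwo_one, ofCyclicTwo_ofAdd_one, *]

end

theorem nonempty_mulEquiv_of_encard_le_four {G : Type*} [Group G]
    (hG : (univ : Set G).encard ≤ 4) :
    Nonempty (G ≃* L 1) ∨ Nonempty (G ≃* Cgrp 2) ∨ Nonempty (G ≃* Cgrp 3) ∨
      Nonempty (G ≃* Cgrp 4) ∨ Nonempty (G ≃* (Cgrp 2 × Cgrp 2)) := by
  have hfin : (univ : Set G).Finite := finite_of_encard_le_coe hG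
  have : Finite G := finite_univ_iff.1 hfin
  have hcard : Nat.card G ≤ 4 := by
    rw [← hfin.cast_ncard_eq, ncard_univ] at hG
    exact_mod_cast hG
  have hpos := Nat.card_pos (α := G)
  obtain ⟨n, hn⟩ : ∃ n, Nat.card G = n := ⟨_, rfl⟩
  rw [hn] at hcard hpos
  have hC : ∀ m, Nat.card (Cgrp m) = m := fun m =>
    (Nat.card_congr Multiplicative.toAdd).trans (Nat.card_zmod m)
  interval_cases n
  · have := (Nat.card_eq_one_iff_unique.1 hn).1
    have : Subsingleton (L 1) := inferInstanceAs (Subsingleton (Fin 1))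
    exact Or.inl ⟨⟨⟨fun _ => (0 : Fin 1), fun _ => 1, fun _ => Subsingleton.elim _ _,
      fun _ => Subsingleton.elim _ _⟩, fun _ _ => Subsingleton.elim _ _⟩⟩
  · have : Fact (Nat.Prime 2) := ⟨Nat.prime_two⟩
    exact Or.inr (Or.inl ⟨mulEquivOfPrimeCardEq hn (hC 2)⟩)
  · have : Fact (Nat.Prime 3) := ⟨Nat.prime_three⟩
    exact Or.inr (Or.inr (Or.inl ⟨mulEquivOfPrimeCardEq hn (hC 3)⟩))
  · by_cases hcyc : IsCyclic G
    · exact Or.inr (Or.inr (Or.inr (Or.inl ⟨mulEquivOfCyclicCardEq (hn.trans (hC 4).symm)⟩)))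
    · have h1 : IsKleinFour G := ⟨hn, (not_isCyclic_iff_exponent_eq_prime Nat.prime_two
        (by rw [hn]; rfl)).1 hcyc⟩
      have hc4 : Nat.card (Cgrp 2 × Cgrp 2) = 4 := by rw [Nat.card_prod, hC]
      have h2 : IsKleinFour (Cgrp 2 × Cgrp 2) := ⟨hc4, by
        rw [Monoid.exponent_prod, Monoid.exponent_multiplicative, ZMod.exponent]
        rfl⟩
      exact Or.inr (Or.inr (Or.inr (Or.inr IsKleinFour.nonempty_mulEquiv)))

theorem nonempty_mulEquiv_cyclic_osum {X : Type*} [Semigroup X] [Finite X] {f s : X}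
    (hff : f * f = f) (hss : s * s = f) (hfs : f * s = s) (hsf : s ≠ f)
    (hc : ∀ x y : X, x * y = y * x) (hbot : ∀ x, x ≠ f → x ≠ s → f * x = f ∧ s * x = s)
    (hl : ∀ x y : X, x ≠ f → x ≠ s → y ≠ f → y ≠ s → x * y = x ∨ x * y = y) :
    ∃ n, Nonempty (X ≃* OSum (Cgrp 2) (L n)) := by
  let S : Subsemigroup X :=
    { carrier := {x | x ≠ f ∧ x ≠ s}
      mul_mem' := fun {a b} ha hb => by
        rcases hl a b ha.1 ha.2 hb.1 hb.2 with h | h <;> rw [h] <;> assumption }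
  obtain ⟨n, ⟨ψ⟩⟩ := exists_mulEquiv_linear (X := S) (fun x y => Subtype.ext (hc _ _)) fun x y =>
    (hl x y x.2.1 x.2.2 y.2.1 y.2.2).imp (fun h => Subtype.ext h) fun h => Subtype.ext h
  have hbot' : ∀ (c : Cgrp 2) (x : S), ofCyclicTwo f s c * x = ofCyclicTwo f s c := fun c x => by
    rcases ofCyclicTwo_mem (a := f) (b := s) c with h | h <;> rw [h]
    · exact (hbot x x.2.1 x.2.2).1
    · exact (hbot x x.2.1 x.2.2).2
  have hne : ∀ (c : Cgrp 2) (x : S), ofCyclicTwo f s c ≠ x := fun c x => by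
    rcases ofCyclicTwo_mem (a := f) (b := s) c with h | h <;> rw [h]
    · exact x.2.1.symm
    · exact x.2.2.symm
  let F : OSum (Cgrp 2) (L n) → X :=
    Sum.elim (ofCyclicTwo f s) fun l => (ψ.symm l : S).1
  have hF : Function.Bijective F := by
    constructor
    · exact (ofCyclicTwo_injective hsf.symm).sumElim
        (Subtype.val_injective.comp ψ.symm.injective) fun c l => hne c _
    · intro x
      by_cases h1 : x = f
      · exact ⟨Sum.inl 1, ofCyclicTwo_one.trans h1.symm⟩
      by_cases h2 : x = s
      · exact ⟨Sum.inl (Multiplicative.ofAdd 1), ofCyclicTwo_ofAdd_one.trans h2.symm⟩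
      exact ⟨Sum.inr (ψ ⟨x, h1, h2⟩), by simp [F]⟩
  have hmul : ∀ x y, F (x * y) = F x * F y := by
    rintro (c | l) (c' | l')
    · exact ofCyclicTwo_mul hff hfs (by rw [hc, hfs]) hss c c'
    · exact (hbot' c _).symm
    · exact ((hc _ _).trans (hbot' c' _)).symm
    · exact congrArg Subtype.val (map_mul ψ.symm l l')
  exact ⟨n, ⟨(⟨Equiv.ofBijective F hF, hmul⟩ : OSum (Cgrp 2) (L n) ≃* X).symm⟩⟩

theorem nonempty_mulEquiv_one_osum {X : Type*} [Semigroup X] {e f s : X} (hee : e * e = e)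
    (hff : f * f = f) (hss : s * s = f) (hfs : f * s = s) (hsf : s ≠ f) (hef : e ≠ f)
    (hes : e ≠ s) (hc : ∀ x y : X, x * y = y * x) (hf : e * f = e) (hs : e * s = e)
    (hX : ∀ x, x = e ∨ x = f ∨ x = s) : Nonempty (X ≃* OSum (L 1) (Cgrp 2)) := by
  have hbot : ∀ c : Cgrp 2, e * ofCyclicTwo f s c = e := fun c => by
    rcases ofCyclicTwo_mem (a := f) (b := s) c with h | h <;> rw [h] <;> assumption
  let F : OSum (L 1) (Cgrp 2) → X := Sum.elim (fun _ => e) (ofCyclicTwo f s)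
  have hF : Function.Bijective F := by
    constructor
    · have : Subsingleton (L 1) := inferInstanceAs (Subsingleton (Fin 1))
      refine (Function.injective_of_subsingleton _).sumElim (ofCyclicTwo_injective hsf.symm) ?_
      intro _ c
      rcases ofCyclicTwo_mem (a := f) (b := s) c with h | h <;> rw [h] <;> assumption
    · intro x
      rcases hX x with rfl | rfl | rfl
      · exact ⟨Sum.inl (0 : Fin 1), rfl⟩
      · exact ⟨Sum.inr 1, ofCyclicTwo_one⟩
      · exact ⟨Sum.inr (Multiplicative.ofAdd 1), ofCyclicTwo_ofAdd_one⟩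
  have hmul : ∀ x y, F (x * y) = F x * F y := by
    rintro (l | c) (l' | c')
    · exact hee.symm
    · exact (hbot c').symm
    · exact ((hc _ _).trans (hbot c)).symm
    · exact ofCyclicTwo_mul hff hfs (by rw [hc, hfs]) hss c c'
  exact ⟨(⟨Equiv.ofBijective F hF, hmul⟩ : OSum (L 1) (Cgrp 2) ≃* X).symm⟩

theorem nonempty_mulEquiv_linear_prod_cyclic {X : Type*} [Semigroup X] {e t f s : X}
    (hee : e * e = e) (htt : t * t = e) (het : e * t = t) (hff : f * f = f) (hss : s * s = f)
    (hfs : f * s = s) (hef : e * f = e) (hes : e * s = t) (hte : t ≠ e) (hsf : s ≠ f)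
    (h1 : ∀ x y, (x = e ∨ x = t) → (y = f ∨ y = s) → x ≠ y) (hc : ∀ x y : X, x * y = y * x)
    (hX : ∀ x, x = e ∨ x = t ∨ x = f ∨ x = s) : Nonempty (X ≃* (L 2 × Cgrp 2)) := by
  have hte' : t * e = t := by rw [hc, het]
  have hsf' : s * f = s := by rw [hc, hfs]
  have htf : t * f = t := by rw [← hes, mul_assoc, hsf']
  have hts : t * s = e := by rw [← hes, mul_assoc, hss, hef]
  have h2 : ∀ l : L 2, l = (0 : Fin 2) ∨ l = (1 : Fin 2) :=
    Fin.forall_fin_two.2 ⟨Or.inl rfl, Or.inr rfl⟩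
  let F : L 2 × Cgrp 2 → X := fun p =>
    (![ofCyclicTwo e t, ofCyclicTwo f s] : Fin 2 → Cgrp 2 → X) p.1 p.2
  have F0 : ∀ c, F ((0 : Fin 2), c) = ofCyclicTwo e t c := fun _ => rfl
  have F1 : ∀ c, F ((1 : Fin 2), c) = ofCyclicTwo f s c := fun _ => rfl
  have hF : Function.Bijective F := by
    constructor
    · rintro ⟨l, c⟩ ⟨l', c'⟩ h
      rcases h2 l with rfl | rfl <;> rcases h2 l' with rfl | rfl
      · rw [F0, F0] at h
        rw [ofCyclicTwo_injective hte.symm h]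
      · rw [F0, F1] at h
        exact absurd h (h1 _ _ (ofCyclicTwo_mem _) (ofCyclicTwo_mem _))
      · rw [F0, F1] at h
        exact absurd h.symm (h1 _ _ (ofCyclicTwo_mem _) (ofCyclicTwo_mem _))
      · rw [F1, F1] at h
        rw [ofCyclicTwo_injective hsf.symm h]
    · intro x
      rcases hX x with rfl | rfl | rfl | rfl
      · exact ⟨((0 : Fin 2), 1), (F0 _).trans ofCyclicTwo_one⟩
      · exact ⟨((0 : Fin 2), Multiplicative.ofAdd 1), (F0 _).trans ofCyclicTwo_ofAdd_one⟩
      · exact ⟨((1 : Fin 2), 1), (F1 _).trans ofCyclicTwo_one⟩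
      · exact ⟨((1 : Fin 2), Multiplicative.ofAdd 1), (F1 _).trans ofCyclicTwo_ofAdd_one⟩
  have hmix : ∀ c d : Cgrp 2,
      ofCyclicTwo e t (c * d) = ofCyclicTwo e t c * ofCyclicTwo f s d := fun c d => by
    have h3 : ofCyclicTwo f s d * e = ofCyclicTwo e t d := by
      rcases cyclic_two_cases d with rfl | rfl
      · rw [ofCyclicTwo_one, ofCyclicTwo_one, hc, hef]
      · rw [ofCyclicTwo_ofAdd_one, ofCyclicTwo_ofAdd_one, hc, hes]
    have h4 : e * ofCyclicTwo e t c = ofCyclicTwo e t c := by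
      rcases ofCyclicTwo_mem (a := e) (b := t) c with h | h <;> rw [h] <;> assumption
    rw [ofCyclicTwo_mul hee het hte' htt, ← h3, ← mul_assoc, hc _ e, ← mul_assoc, h4]
  have hmul : ∀ x y, F (x * y) = F x * F y := by
    rintro ⟨l, c⟩ ⟨l', c'⟩
    rcases h2 l with rfl | rfl <;> rcases h2 l' with rfl | rfl
    · rw [F0, F0, ← ofCyclicTwo_mul hee het hte' htt]
      exact F0 _
    · rw [F0, F1, ← hmix]
      exact F0 _
    · rw [F0, F1, hc, ← hmix, _root_.mul_comm c']
      exact F0 _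
    · rw [F1, F1, ← ofCyclicTwo_mul hff hfs hsf' hss]
      exact F1 _
  exact ⟨(⟨Equiv.ofBijective F hF, hmul⟩ : L 2 × Cgrp 2 ≃* X).symm⟩

theorem eq_or_eq_of_encard_le_two {X : Type*} {H : Set X} {f s x : X} (hH : H.encard ≤ 2)
    (hf : f ∈ H) (hs : s ∈ H) (hsf : s ≠ f) (hx : x ∈ H) : x = f ∨ x = s := by
  have hsub : ({f, s} : Set X) ⊆ H := insert_subset hf (singleton_subset_iff.2 hs)
  have heq : ({f, s} : Set X) = H := (toFinite _).eq_of_subset_of_encard_le hsub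
    (hH.trans (encard_pair hsf.symm).ge)
  rwa [← heq] at hx

theorem mul_self_eq_of_encard_le_two {X : Type*} [Semigroup X] {f s : X} (hf : f * f = f)
    (hH : (maxSubgroup f).encard ≤ 2) (hs : s ∈ maxSubgroup f) (hsf : s ≠ f) : s * s = f := by
  refine (eq_or_eq_of_encard_le_two hH (self_mem_maxSubgroup hf) hs hsf
    (mul_mem_maxSubgroup hs hs)).resolve_right fun h => hsf ?_
  exact mul_right_inj_of_mem_maxSubgroup hs hs.1 hf (h.trans hs.2.1.symm)

namespace SuperextensionCondition

variable {X : Type*} [Semigroup X]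

theorem eq_of_mul_eq_of_mem_maxSubgroup_of_ne (h : SuperextensionCondition X) {e f s p : X}
    (he : e * e = e) (hf : f * f = f) (hef : e * f = e) (hne : e ≠ f)
    (hs : s ∈ maxSubgroup f) (hsf : s ≠ f) (hp : p * p = p) (hpf : p ≠ f) : p = e := by
  have hpf' : p * f = p := by
    refine (h.idem_linear hp hf).resolve_right fun hpf' => hsf ?_
    exact h.eq_of_mem_maxSubgroup_of_between he hf hp hef (by rw [h.mul_comm, hpf']) hne
      hpf.symm hs
  have hss := mul_self_eq_of_encard_le_two hf (h.encard_maxSubgroup_le_two_of_lt he hf hef hne)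
    hs hsf
  have key : ∀ {a b}, a * a = a → b * b = b → a * b = a → a * f = a → b * f = b → b ≠ f →
      a = b := by
    intro a b ha hb hab haf hbf hbne
    by_contra hane
    have hsb : s * b = b := by
      rw [h.mul_comm]
      exact h.eq_of_mem_maxSubgroup_of_between ha hb hf hab hbf hane hbne
        (h.mul_mem_maxSubgroup_of_idem hb hbf hs)
    refine hane (h.eq_of_fixed hf hs.1 hss hsf ?_ ?_ ?_ hsb)
    · rw [h.mul_comm, haf]
    · rw [← hab, h.mul_comm a, ← mul_assoc, hsb]
    · rw [h.mul_comm, hbf]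
  rcases h.idem_linear hp he with hpe | hpe
  · exact key hp he hpe hpf' hef hne
  · exact (key he hp (by rw [h.mul_comm, hpe]) hef hpf' hpf).symm

theorem nonempty_mulEquiv_of_lt (h : SuperextensionCondition X) {e f s : X}
    (he : e * e = e) (hf : f * f = f) (hef : e * f = e) (hne : e ≠ f)
    (hs : s ∈ maxSubgroup f) (hsf : s ≠ f) :
    Nonempty (X ≃* (L 2 × Cgrp 2)) ∨ Nonempty (X ≃* OSum (L 1) (Cgrp 2)) := by
  have hHf := h.encard_maxSubgroup_le_two_of_lt he hf hef hne
  have hHe := h.encard_maxSubgroup_le_two_of_gt he hef hne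
  have hss := mul_self_eq_of_encard_le_two hf hHf hs hsf
  have hX : ∀ x, x ∈ maxSubgroup e ∨ x = f ∨ x = s := fun x => by
    obtain ⟨p, hp, hx⟩ := h.exists_mem_maxSubgroup x
    by_cases hpf : p = f
    · rw [hpf] at hx
      exact Or.inr (eq_or_eq_of_encard_le_two hHf (self_mem_maxSubgroup hf) hs hsf hx)
    · rw [h.eq_of_mul_eq_of_mem_maxSubgroup_of_ne he hf hef hne hs hsf hp hpf] at hx
      exact Or.inl hx
  have hdisj : ∀ x ∈ maxSubgroup e, ∀ y ∈ maxSubgroup f, x ≠ y := by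
    rintro x hx _ hy rfl
    exact hne (eq_of_mul_mem_maxSubgroup hef hy hx.1)
  have hes := h.mul_mem_maxSubgroup_of_idem he hef hs
  have hee := self_mem_maxSubgroup he
  have hff := self_mem_maxSubgroup hf
  by_cases hall : ∀ t ∈ maxSubgroup e, t = e
  · exact Or.inr (nonempty_mulEquiv_one_osum he hf hss hs.1 hsf hne (hdisj e hee s hs) h.mul_comm
      hef (hall _ hes) fun x => (hX x).imp_left (hall x))
  · push Not at hall
    obtain ⟨t, ht, hte⟩ := hall
    have hes' : e * s = t := by
      refine (eq_or_eq_of_encard_le_two hHe hee ht hte hes).resolve_left fun hes' => ?_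
      have hft : f * t = t := by rw [← ht.1, ← mul_assoc, h.mul_comm f, hef]
      have hst : s * t = t := by
        rw [← ht.1, ← mul_assoc, h.mul_comm s, hes']
      exact hte (h.eq_of_fixed hf hs.1 hss hsf hft hst (by rw [h.mul_comm, hef])
        (by rw [h.mul_comm, hes']))
    refine Or.inl (nonempty_mulEquiv_linear_prod_cyclic he
      (mul_self_eq_of_encard_le_two he hHe ht hte) ht.1 hf hss hs.1 hef hes' hte hsf ?_
      h.mul_comm fun x => ?_)
    · rintro x y (rfl | rfl) (rfl | rfl)
      exacts [hne, hdisj _ hee _ hs, hdisj _ ht _ hff, hdisj _ ht _ hs]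
    · rw [← or_assoc]
      exact (hX x).imp_left (eq_or_eq_of_encard_le_two hHe hee ht hte)

theorem nonempty_mulEquiv_of_forall_idem_eq (h : SuperextensionCondition X) {f : X}
    (hf : f * f = f) (hall : ∀ e : X, e * e = e → e = f) :
    Nonempty (X ≃* L 1) ∨ Nonempty (X ≃* Cgrp 2) ∨ Nonempty (X ≃* Cgrp 3) ∨
      Nonempty (X ≃* Cgrp 4) ∨ Nonempty (X ≃* (Cgrp 2 × Cgrp 2)) := by
  let := maxSubgroupGroup hf
  have hmem : ∀ x, x ∈ maxSubgroup f := fun x => by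
    obtain ⟨e, he, hx⟩ := h.exists_mem_maxSubgroup x
    rwa [hall e he] at hx
  let φ : X ≃* maxSubgroup f :=
    ⟨⟨fun x => ⟨x, hmem x⟩, Subtype.val, fun _ => rfl, fun _ => rfl⟩, fun _ _ => rfl⟩
  exact (nonempty_mulEquiv_of_encard_le_four ((encard_univ (maxSubgroup f)).le.trans
    (h.encard_maxSubgroup_le_four hf))).imp (fun ⟨ψ⟩ => ⟨φ.trans ψ⟩) <|
    Or.imp (fun ⟨ψ⟩ => ⟨φ.trans ψ⟩) <| Or.imp (fun ⟨ψ⟩ => ⟨φ.trans ψ⟩) <|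
    Or.imp (fun ⟨ψ⟩ => ⟨φ.trans ψ⟩) (fun ⟨ψ⟩ => ⟨φ.trans ψ⟩)

theorem nonempty_mulEquiv_of_forall_le (h : SuperextensionCondition X) {e f s : X}
    (he : e * e = e) (hf : f * f = f) (hne : e ≠ f) (hs : s ∈ maxSubgroup f) (hsf : s ≠ f)
    (hmin : ∀ e f s : X, e * e = e → f * f = f → s ∈ maxSubgroup f → s ≠ f → e * f = e → e = f) :
    ∃ n, Nonempty (X ≃* OSum (Cgrp 2) (L n)) := by
  have := h.finite
  have hbot : ∀ {g}, g * g = g → f * g = f := fun {g} hg => by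
    rcases h.idem_linear hf hg with hfg | hfg
    · exact hfg
    · rw [hmin g f s hg hf hs hsf (by rw [h.mul_comm, hfg]), hf]
  have hHf := h.encard_maxSubgroup_le_two_of_gt hf (hbot he) hne.symm
  have hidem : ∀ x, x ≠ f → x ≠ s → x * x = x := fun x hxf hxs => by
    obtain ⟨g, hg, hx⟩ := h.exists_mem_maxSubgroup x
    by_cases hxg : x = g
    · rw [hxg, hg]
    · rw [← hmin f g x hf hg hx hxg (hbot hg)] at hx
      exact absurd (eq_or_eq_of_encard_le_two hHf (self_mem_maxSubgroup hf) hs hsf hx)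
        (not_or.2 ⟨hxf, hxs⟩)
  refine nonempty_mulEquiv_cyclic_osum hf (mul_self_eq_of_encard_le_two hf hHf hs hsf) hs.1 hsf
    h.mul_comm (fun x hxf hxs => ?_) fun x y hxf hxs hyf hys =>
      h.idem_linear (hidem x hxf hxs) (hidem y hyf hys)
  have hfx := hbot (hidem x hxf hxs)
  exact ⟨hfx, by rw [← hs.2.1, mul_assoc, hfx]⟩

theorem classification (h : SuperextensionCondition X) :
    Nonempty (X ≃* Cgrp 2) ∨ Nonempty (X ≃* Cgrp 3) ∨ Nonempty (X ≃* Cgrp 4) ∨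
      Nonempty (X ≃* (Cgrp 2 × Cgrp 2)) ∨ Nonempty (X ≃* (L 2 × Cgrp 2)) ∨
      Nonempty (X ≃* OSum (L 1) (Cgrp 2)) ∨ (∃ n : ℕ, Nonempty (X ≃* L n)) ∨
      (∃ n : ℕ, Nonempty (X ≃* OSum (Cgrp 2) (L n))) := by
  have := h.finite
  by_cases hband : ∀ x : X, x * x = x
  · have := exists_mulEquiv_linear h.mul_comm fun x y => h.idem_linear (hband x) (hband y)
    tauto
  push Not at hband
  obtain ⟨s, hs⟩ := hband
  obtain ⟨f, hf, hsf⟩ := h.exists_mem_maxSubgroup s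
  have hne : s ≠ f := by
    rintro rfl
    exact hs hf
  by_cases hmin : ∀ e f s : X, e * e = e → f * f = f → s ∈ maxSubgroup f → s ≠ f → e * f = e →
      e = f
  · by_cases hall : ∀ e : X, e * e = e → e = f
    · rcases h.nonempty_mulEquiv_of_forall_idem_eq hf hall with h1 | h1
      · have : ∃ n, Nonempty (X ≃* L n) := ⟨1, h1⟩
        tauto
      · tauto
    · push Not at hall
      obtain ⟨e, he, hef⟩ := hall
      have := h.nonempty_mulEquiv_of_forall_le he hf hef hsf hne hmin
      tauto
  · push Not at hmin
    obtain ⟨e, f, s, he, hf, hs, hsf, hef, hne⟩ := hmin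
    have := h.nonempty_mulEquiv_of_lt he hf hef hne hs hsf
    tauto

end SuperextensionCondition

/-- Theorem 1.1: for a semigroup `X`, the following are equivalent:
(1) `λ(X)` is a commutative Clifford semigroup;
(2) `λ(X)` is an inverse semigroup;
(3) the idempotents of `λ(X)` commute and `λ(X)` is sub-Clifford or regular in `N₂(X)`;
(4) `X` is a finite commutative Clifford semigroup isomorphic to one of
`C₂`, `C₃`, `C₄`, `C₂×C₂`, `L₂×C₂`, `L₁⊔C₂`, `Lₙ`, or `C₂⊔Lₙ` for some `n ∈ ω`. -/
theorem superextension_inverse_characterization (X : Type*) [Semigroup X] :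
    List.TFAE
      [commOn (lambdaS X) ∧ cliffordOn (lambdaS X),
        inverseOn (lambdaS X),
        idemCommOn (lambdaS X) ∧ (subCliffordOn (lambdaS X) ∨ regularIn (lambdaS X) (N2S X)),
        (Finite X ∧ (∀ x y : X, x * y = y * x) ∧
            (∀ x : X, ∃ H : Set X, IsSubgroupIn H ∧ x ∈ H)) ∧
          (Nonempty (X ≃* Cgrp 2) ∨ Nonempty (X ≃* Cgrp 3) ∨ Nonempty (X ≃* Cgrp 4) ∨
            Nonempty (X ≃* (Cgrp 2 × Cgrp 2)) ∨ Nonempty (X ≃* (L 2 × Cgrp 2)) ∨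
            Nonempty (X ≃* OSum (L 1) (Cgrp 2)) ∨ (∃ n : ℕ, Nonempty (X ≃* L n)) ∨
            (∃ n : ℕ, Nonempty (X ≃* OSum (Cgrp 2) (L n))))] := by
  tfae_have 1 → 2 := fun ⟨hc, hC⟩ => inverseOn_of_commOn_of_cliffordOn hc hC
  tfae_have 2 → 3 := fun hI => by
    refine ⟨idemCommOn_of_inverseOn (fun a ha b hb => Upfamily.lambdaS_mul ha hb) hI,
      Or.inr fun a ha => ?_⟩
    obtain ⟨b, ⟨hb, hab, -⟩, -⟩ := hI a ha
    exact ⟨b, Upfamily.linked_of_mem_lambdaS hb, hab⟩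
  tfae_have 3 → 4 := fun h => by
    replace h : SuperextensionCondition X := h
    refine ⟨⟨h.finite, h.mul_comm, fun x => ?_⟩, h.classification⟩
    obtain ⟨d, hd⟩ := h.exists_ppow_eq_self x
    exact ⟨_, isSubgroupIn_range_ppow hd, 0, rfl⟩
  tfae_have 4 → 1 := fun ⟨_, hX⟩ => by
    have h : SuperextensionCommPeriodic X := by
      rcases hX with hX | hX | hX | hX | hX | hX | ⟨n, hX⟩ | ⟨n, hX⟩
      exacts [superextensionCommPeriodic_cyclic_two.of_mulEquiv hX,
        superextensionCommPeriodic_cyclic_three.of_mulEquiv hX,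
        superextensionCommPeriodic_cyclic_four.of_mulEquiv hX,
        superextensionCommPeriodic_prod_cyclic_two.of_mulEquiv hX,
        superextensionCommPeriodic_linear_prod_cyclic.of_mulEquiv hX,
        superextensionCommPeriodic_one_osum.of_mulEquiv hX,
        (superextensionCommPeriodic_linear n).of_mulEquiv hX,
        (superextensionCommPeriodic_osum n).of_mulEquiv hX]
    exact ⟨h.1, h.cliffordOn⟩
  tfae_finish
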